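/- Let Δ = (T, 𝒮, ℬ) be a strong triangle blocking arrangement with vertices x₁, x₂, x₃ of T. Suppose there are vertices a₁, b₁ ∈ x₁x₂ and a₂, b₂ ∈ x₂x₃ such that x₁, b₁, a₁, x₂ appear in this order on the edge x₁x₂, x₃, a₂, b₂, x₂ appear in this order on the edge x₂x₃, and a₁a₂, b₁b₂ are proper initial segments intersecting at a point c. Let Q be the quadrilateral 𝒮̄-region with vertices a₁, x₂, b₂, c, bounded by the subsegment a₁x₂ of x₁x₂, the subsegment x₂b₂ of x₂x₃, the subsegment b₂c of b₁b₂ and the subsegment ca₁ of a₁a₂. Then the vertices x₂ and c are internally blocked in Q. -/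

import Mathlib

open Set

noncomputable section

/-- Points of the real plane. -/
abbrev Pt := ℝ × ℝ

/-- The boundary of the triangle with vertices `x1`, `x2`, `x3`:
the union of its three edges. -/
def triBdry (x1 x2 x3 : Pt) : Set Pt :=
  segment ℝ x1 x2 ∪ segment ℝ x2 x3 ∪ segment ℝ x3 x1

/-- The three edges of the triangle with vertices `x1`, `x2`, `x3`. -/
def triEdges (x1 x2 x3 : Pt) : Set (Set Pt) :=
  {segment ℝ x1 x2, segment ℝ x2 x3, segment ℝ x3 x1}

/-- A triangle blocking arrangement: a nondegenerate triangle `x1 x2 x3` together with two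
finite collections `S` (proper initial segments) and `B` (blocking segments) of closed
segments with endpoints on the boundary of the triangle and no interior point on the
boundary, satisfying the intersection conditions (i) and (ii). `S ∪ triEdges x1 x2 x3`
is the collection of initial segments `𝒮̄`. -/
structure TBA where
  x1 : Pt
  x2 : Pt
  x3 : Pt
  S : Set (Set Pt)
  B : Set (Set Pt)
  indep : AffineIndependent ℝ ![x1, x2, x3]
  finS : S.Finite
  finB : B.Finite
  seg_wf : ∀ s ∈ S ∪ B, ∃ a b : Pt, a ≠ b ∧ s = segment ℝ a b ∧
    a ∈ triBdry x1 x2 x3 ∧ b ∈ triBdry x1 x2 x3 ∧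
    ∀ p ∈ openSegment ℝ a b, p ∉ triBdry x1 x2 x3
  /- (i) no three initial segments are concurrent … -/
  no_three_concurrent : ∀ s₁ ∈ S ∪ triEdges x1 x2 x3, ∀ s₂ ∈ S ∪ triEdges x1 x2 x3,
    ∀ s₃ ∈ S ∪ triEdges x1 x2 x3, s₁ ≠ s₂ → s₁ ≠ s₃ → s₂ ≠ s₃ →
    ¬ ∃ p : Pt, p ∈ s₁ ∧ p ∈ s₂ ∧ p ∈ s₃
  /- … and through every intersection point of two initial segments, not both edges,
  there is a unique blocking segment … -/
  block_exists : ∀ s₁ ∈ S ∪ triEdges x1 x2 x3, ∀ s₂ ∈ S ∪ triEdges x1 x2 x3, s₁ ≠ s₂ →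
    ¬ (s₁ ∈ triEdges x1 x2 x3 ∧ s₂ ∈ triEdges x1 x2 x3) →
    ∀ p : Pt, p ∈ s₁ → p ∈ s₂ → ∃! b, b ∈ B ∧ p ∈ b
  /- … while through an intersection point of two edges there is at most one
  blocking segment. -/
  block_unique : ∀ s₁ ∈ S ∪ triEdges x1 x2 x3, ∀ s₂ ∈ S ∪ triEdges x1 x2 x3, s₁ ≠ s₂ →
    ∀ p : Pt, p ∈ s₁ → p ∈ s₂ → ∀ b₁ ∈ B, ∀ b₂ ∈ B, p ∈ b₁ → p ∈ b₂ → b₁ = b₂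
  /- (ii) through every intersection point of an initial segment and a blocking segment
  there is a unique second initial segment. -/
  second_segment : ∀ s ∈ S ∪ triEdges x1 x2 x3, ∀ b ∈ B, ∀ p : Pt, p ∈ s → p ∈ b →
    ∃! s', s' ∈ S ∪ triEdges x1 x2 x3 ∧ s' ≠ s ∧ p ∈ s'

namespace TBA

variable (Δ : TBA)

/-- The collection `𝒮̄` of initial segments. -/
def Sbar : Set (Set Pt) := Δ.S ∪ triEdges Δ.x1 Δ.x2 Δ.x3

/-- The (closed) triangle `T`. -/
def tri : Set Pt := convexHull ℝ {Δ.x1, Δ.x2, Δ.x3}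

/-- The boundary `∂T`. -/
def bdry : Set Pt := triBdry Δ.x1 Δ.x2 Δ.x3

/-- A vertex of the arrangement: an intersection point of two initial segments. -/
def IsVertex (p : Pt) : Prop :=
  ∃ s₁ ∈ Δ.Sbar, ∃ s₂ ∈ Δ.Sbar, s₁ ≠ s₂ ∧ p ∈ s₁ ∧ p ∈ s₂

/-- The segment `xy` is minimal if no vertex of the arrangement lies in its interior. -/
def MinimalSeg (x y : Pt) : Prop :=
  ∀ p ∈ openSegment ℝ x y, ¬ Δ.IsVertex p

/-- An `𝒮̄`-region: the closure of a connected component of `T \ ⋃ L` for some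
subset `L` of `𝒮̄`. -/
def IsRegion (R : Set Pt) : Prop :=
  ∃ L ⊆ Δ.Sbar, ∃ p ∈ Δ.tri \ ⋃₀ L,
    R = closure (connectedComponentIn (Δ.tri \ ⋃₀ L) p)

/-- A minimal `𝒮̄`-region: the closure of a connected component of `T \ ⋃ 𝒮̄`. -/
def IsMinRegion (R : Set Pt) : Prop :=
  ∃ p ∈ Δ.tri \ ⋃₀ Δ.Sbar,
    R = closure (connectedComponentIn (Δ.tri \ ⋃₀ Δ.Sbar) p)

/-- The set `s` contains an edge of the region `R`: it contains a nondegenerate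
segment lying on the boundary of `R`. -/
def ContainsEdgeOf (_Δ : TBA) (s R : Set Pt) : Prop :=
  ∃ q₁ q₂ : Pt, q₁ ≠ q₂ ∧ segment ℝ q₁ q₂ ⊆ s ∩ frontier R

/-- A vertex of the region `R`: a point of `R` that is the intersection of two initial
segments, each containing an edge of `R`. -/
def IsRegionVertex (R : Set Pt) (p : Pt) : Prop :=
  p ∈ R ∧ ∃ s₁ ∈ Δ.Sbar, ∃ s₂ ∈ Δ.Sbar, s₁ ≠ s₂ ∧ p ∈ s₁ ∧ p ∈ s₂ ∧
    Δ.ContainsEdgeOf s₁ R ∧ Δ.ContainsEdgeOf s₂ R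

/-- A vertex `p` is internally blocked in the region `R` if the blocking segment
through `p` exists and meets the interior of `R`.  (Externally blocked means not
internally blocked.) -/
def InternallyBlocked (R : Set Pt) (p : Pt) : Prop :=
  ∃ b ∈ Δ.B, p ∈ b ∧ (b ∩ interior R).Nonempty

/-- Two consecutive vertices of a region `R`: distinct vertices joined by an edge
lying on the boundary of `R`. -/
def Consec (R : Set Pt) (u v : Pt) : Prop :=
  u ≠ v ∧ Δ.IsRegionVertex R u ∧ Δ.IsRegionVertex R v ∧ segment ℝ u v ⊆ frontier R

/-- Condition (A): the arrangement is strong when for every minimal `𝒮̄`-region `R` and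
consecutive vertices `v₁, v₂, v₃, v₄, v₅` in this order along `∂R`, if the line
`l(v₁v₂)` and the blocking segment `β(v₃)` intersect inside `T`, and `β(v₃)` meets the
interior of `R`, then `l(v₁v₂)`, `β(v₃)` and `l(v₄v₅)` are concurrent. -/
def Strong : Prop :=
  ∀ R : Set Pt, Δ.IsMinRegion R →
  ∀ v₁ v₂ v₃ v₄ v₅ : Pt, List.Pairwise (· ≠ ·) [v₁, v₂, v₃, v₄, v₅] →
    Δ.Consec R v₁ v₂ → Δ.Consec R v₂ v₃ → Δ.Consec R v₃ v₄ → Δ.Consec R v₄ v₅ →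
    ∀ b ∈ Δ.B, v₃ ∈ b → (b ∩ interior R).Nonempty →
    (∃ q ∈ Δ.tri, q ∈ affineSpan ℝ ({v₁, v₂} : Set Pt) ∧ q ∈ b) →
    ∃ q : Pt, q ∈ b ∧ q ∈ affineSpan ℝ ({v₁, v₂} : Set Pt) ∧
      q ∈ affineSpan ℝ ({v₄, v₅} : Set Pt)

end TBA

namespace TBA

/-! ### Affine functionals on the plane -/

/-- The affine functional with the given coefficients. -/
def aff (k : ℝ × ℝ × ℝ) (q : Pt) : ℝ := k.1 * q.1 + k.2.1 * q.2 + k.2.2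

theorem aff_comb (k : ℝ × ℝ × ℝ) (x y : Pt) {a b : ℝ} (h : a + b = 1) :
    aff k (a • x + b • y) = a * aff k x + b * aff k y := by
  obtain rfl : b = 1 - a := by linarith
  simp only [aff, Prod.fst_add, Prod.snd_add, Prod.smul_fst, Prod.smul_snd, smul_eq_mul]
  ring

theorem aff_ray (k : ℝ × ℝ × ℝ) (x y : Pt) (t : ℝ) :
    aff k (x + t • (y - x)) = aff k x + t * (aff k y - aff k x) := by
  simp only [aff, Prod.fst_add, Prod.snd_add, Prod.smul_fst, Prod.smul_snd, smul_eq_mul,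
    Prod.fst_sub, Prod.snd_sub]
  ring

theorem aff_continuous (k : ℝ × ℝ × ℝ) : Continuous (aff k) := by
  unfold aff; fun_prop

/-- Twice the signed area of the triangle `u v q`. -/
def cross (u v q : Pt) : ℝ := (v.1 - u.1) * (q.2 - u.2) - (v.2 - u.2) * (q.1 - u.1)

theorem cross_eq_aff (u v : Pt) (c : ℝ) : ∃ k : ℝ × ℝ × ℝ,
    (∀ q, aff k q = cross u v q * c) ∧ (u ≠ v → c ≠ 0 → k.1 ≠ 0 ∨ k.2.1 ≠ 0) := by
  refine ⟨(-(v.2 - u.2) * c, (v.1 - u.1) * c, (-(v.1 - u.1) * u.2 + (v.2 - u.2) * u.1) * c),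
    fun q => by simp only [aff, cross]; ring, fun h hc => ?_⟩
  by_contra hcon
  push Not at hcon
  obtain ⟨h1, h2⟩ := hcon
  have h1' : v.2 - u.2 = 0 := by linarith [(mul_eq_zero.1 h1).resolve_right hc]
  have h2' : v.1 - u.1 = 0 := by simpa [hc] using h2
  exact h (Prod.ext (by linarith) (by linarith))

theorem exists_of_cross_eq_zero {u v q : Pt} (h : u ≠ v) (hq : cross u v q = 0) :
    ∃ t : ℝ, q = u + t • (v - u) := by
  unfold cross at hq
  by_cases h1 : v.1 - u.1 = 0
  · have h2 : v.2 - u.2 ≠ 0 := fun h2 => h (Prod.ext (by linarith) (by linarith))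
    have h3 : q.1 - u.1 = 0 := by
      rw [h1] at hq
      have : (v.2 - u.2) * (q.1 - u.1) = 0 := by linarith
      exact (mul_eq_zero.1 this).resolve_left h2
    refine ⟨(q.2 - u.2) / (v.2 - u.2), Prod.ext ?_ ?_⟩
    · simp [h1]; linarith
    · simp; field_simp; ring
  · refine ⟨(q.1 - u.1) / (v.1 - u.1), Prod.ext ?_ ?_⟩
    · simp; field_simp; ring
    · simp; field_simp; linarith

theorem mem_hull3 {x y z q : Pt} : q ∈ convexHull ℝ ({x, y, z} : Set Pt) ↔
    ∃ a b c : ℝ, 0 ≤ a ∧ 0 ≤ b ∧ 0 ≤ c ∧ a + b + c = 1 ∧ q = a • x + b • y + c • z := by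
  constructor
  · intro h
    rw [convexHull_insert (by simp), convexHull_pair, mem_convexJoin] at h
    obtain ⟨x', hx', w, ⟨b, c, hb, hc, hbc, rfl⟩, ⟨s, t, hs, ht, hst, rfl⟩⟩ := h
    rw [mem_singleton_iff] at hx'
    subst hx'
    refine ⟨s, t * b, t * c, hs, by positivity, by positivity, ?_, ?_⟩
    · rw [add_assoc, ← mul_add, hbc, mul_one, hst]
    · simp only [smul_add, smul_smul, add_assoc]
  · rintro ⟨a, b, c, ha, hb, hc, habc, rfl⟩
    have hconv := convex_convexHull ℝ ({x, y, z} : Set Pt)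
    have hx : x ∈ convexHull ℝ ({x, y, z} : Set Pt) := subset_convexHull _ _ (by simp)
    have hy : y ∈ convexHull ℝ ({x, y, z} : Set Pt) := subset_convexHull _ _ (by simp)
    have hz : z ∈ convexHull ℝ ({x, y, z} : Set Pt) := subset_convexHull _ _ (by simp)
    have := hconv.sum_mem (t := Finset.univ) (w := ![a, b, c]) (z := ![x, y, z])
      (by intro i _; fin_cases i <;> simpa) (by simp [Fin.sum_univ_three, habc])
      (by intro i _; fin_cases i <;> simpa)
    simpa [Fin.sum_univ_three] using this

theorem cross_comb (u v x y z : Pt) {a b c : ℝ} (h : a + b + c = 1) :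
    cross u v (a • x + b • y + c • z) = a * cross u v x + b * cross u v y + c * cross u v z := by
  obtain rfl : c = 1 - a - b := by linarith
  simp [cross]; ring

theorem eq_bary {x y z : Pt} (h : cross x y z ≠ 0) (q : Pt) :
    q = (cross y z q / cross x y z) • x + (cross z x q / cross x y z) • y +
      (cross x y q / cross x y z) • z := by
  apply Prod.ext
  · simp; field_simp; simp only [cross]; ring
  · simp; field_simp; simp only [cross]; ring

theorem mem_hull3_iff_cross {x y z : Pt} (h : cross x y z ≠ 0) (q : Pt) :
    q ∈ convexHull ℝ ({x, y, z} : Set Pt) ↔ 0 ≤ cross x y q * cross x y z ∧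
      0 ≤ cross y z q * cross x y z ∧ 0 ≤ cross z x q * cross x y z := by
  have hpos : 0 < cross x y z * cross x y z := mul_self_pos.2 h
  rw [mem_hull3]
  constructor
  · rintro ⟨a, b, c, ha, hb, hc, habc, rfl⟩
    rw [cross_comb _ _ _ _ _ habc, cross_comb _ _ _ _ _ habc, cross_comb _ _ _ _ _ habc]
    have e1 : cross x y x = 0 := by simp [cross]
    have e2 : cross x y y = 0 := by simp [cross]; ring
    have e3 : cross y z x = cross x y z := by simp [cross]; ring
    have e4 : cross y z y = 0 := by simp [cross]
    have e5 : cross y z z = 0 := by simp [cross]; ring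
    have e6 : cross z x x = 0 := by simp [cross]; ring
    have e7 : cross z x y = cross x y z := by simp [cross]; ring
    have e8 : cross z x z = 0 := by simp [cross]
    simp only [e1, e2, e3, e4, e5, e6, e7, e8, mul_zero, add_zero, zero_add, mul_assoc]
    exact ⟨by positivity, by positivity, by positivity⟩
  · rintro ⟨h1, h2, h3⟩
    have key : ∀ r, 0 ≤ r * cross x y z → 0 ≤ r / cross x y z := fun r hr => by
      have : r / cross x y z = r * cross x y z / (cross x y z * cross x y z) := by field_simp
      rw [this]; positivity
    refine ⟨_, _, _, key _ h2, key _ h3, key _ h1, ?_, eq_bary h q⟩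
    field_simp
    simp only [cross]; ring

theorem segment_iff_cross {x y z : Pt} (h : cross x y z ≠ 0) (q : Pt) :
    q ∈ segment ℝ x y ↔ q ∈ convexHull ℝ ({x, y, z} : Set Pt) ∧ cross x y q = 0 := by
  constructor
  · rintro ⟨a, b, ha, hb, hab, rfl⟩
    refine ⟨mem_hull3.2 ⟨a, b, 0, ha, hb, le_rfl, by linarith, by simp⟩, ?_⟩
    have := cross_comb x y x y z (a := a) (b := b) (c := 0) (by linarith)
    simp only [zero_smul, add_zero, zero_mul] at this
    rw [this]
    simp only [cross]; ring
  · rintro ⟨hq, h0⟩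
    obtain ⟨a, b, c, ha, hb, hc, habc, rfl⟩ := mem_hull3.1 hq
    rw [cross_comb _ _ _ _ _ habc] at h0
    have e1 : cross x y x = 0 := by simp [cross]
    have e2 : cross x y y = 0 := by simp [cross]; ring
    have : c = 0 := by
      rw [e1, e2] at h0
      simpa [h] using h0
    subst this
    exact ⟨a, b, ha, hb, by linarith, by simp⟩

/-! ### Equations of the segments of an arrangement -/

variable (Δ : TBA)

/-- The orientation of the triangle. -/
def ori : ℝ := cross Δ.x1 Δ.x2 Δ.x3

theorem ori_ne_zero : Δ.ori ≠ 0 := by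
  intro h0
  have := Δ.indep
  rw [affineIndependent_iff_not_collinear_set] at this
  apply this
  rw [collinear_iff_of_mem (p₀ := Δ.x1) (by simp)]
  by_cases h : Δ.x1 = Δ.x2
  · refine ⟨Δ.x3 - Δ.x1, ?_⟩
    intro p hp
    simp only [mem_insert_iff, mem_singleton_iff] at hp
    rcases hp with rfl | rfl | rfl
    · exact ⟨0, by simp⟩
    · exact ⟨0, by simp [h]⟩
    · exact ⟨1, by simp⟩
  · obtain ⟨t, ht⟩ := exists_of_cross_eq_zero h h0
    refine ⟨Δ.x2 - Δ.x1, ?_⟩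
    intro p hp
    simp only [mem_insert_iff, mem_singleton_iff] at hp
    rcases hp with rfl | rfl | rfl
    · exact ⟨0, by simp⟩
    · exact ⟨1, by simp⟩
    · exact ⟨t, by rw [vadd_eq_add, add_comm]; exact ht⟩

theorem ori23 : cross Δ.x2 Δ.x3 Δ.x1 = Δ.ori := by simp only [ori, cross]; ring
theorem ori31 : cross Δ.x3 Δ.x1 Δ.x2 = Δ.ori := by simp only [ori, cross]; ring

theorem mem_tri_iff (q : Pt) : q ∈ Δ.tri ↔ 0 ≤ cross Δ.x1 Δ.x2 q * Δ.ori ∧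
    0 ≤ cross Δ.x2 Δ.x3 q * Δ.ori ∧ 0 ≤ cross Δ.x3 Δ.x1 q * Δ.ori :=
  mem_hull3_iff_cross Δ.ori_ne_zero q

theorem edge12_iff (q : Pt) : q ∈ segment ℝ Δ.x1 Δ.x2 ↔ q ∈ Δ.tri ∧ cross Δ.x1 Δ.x2 q = 0 :=
  segment_iff_cross Δ.ori_ne_zero q

theorem edge23_iff (q : Pt) : q ∈ segment ℝ Δ.x2 Δ.x3 ↔ q ∈ Δ.tri ∧ cross Δ.x2 Δ.x3 q = 0 := by
  have := segment_iff_cross (x := Δ.x2) (y := Δ.x3) (z := Δ.x1)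
    (by rw [ori23]; exact Δ.ori_ne_zero) q
  rwa [show ({Δ.x2, Δ.x3, Δ.x1} : Set Pt) = {Δ.x1, Δ.x2, Δ.x3} by
    ext; simp; tauto] at this

theorem edge31_iff (q : Pt) : q ∈ segment ℝ Δ.x3 Δ.x1 ↔ q ∈ Δ.tri ∧ cross Δ.x3 Δ.x1 q = 0 := by
  have := segment_iff_cross (x := Δ.x3) (y := Δ.x1) (z := Δ.x2)
    (by rw [ori31]; exact Δ.ori_ne_zero) q
  rwa [show ({Δ.x3, Δ.x1, Δ.x2} : Set Pt) = {Δ.x1, Δ.x2, Δ.x3} by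
    ext; simp; tauto] at this

theorem x12_ne : Δ.x1 ≠ Δ.x2 := fun h => Δ.ori_ne_zero (by rw [ori, h]; simp [cross])
theorem x23_ne : Δ.x2 ≠ Δ.x3 := fun h => Δ.ori_ne_zero (by rw [ori, h]; simp [cross]; ring)
theorem x31_ne : Δ.x3 ≠ Δ.x1 := fun h => Δ.ori_ne_zero (by rw [ori, h]; simp [cross])

theorem edge12_ne_23 : segment ℝ Δ.x1 Δ.x2 ≠ segment ℝ Δ.x2 Δ.x3 := fun h => by
  have : Δ.x3 ∈ segment ℝ Δ.x1 Δ.x2 := h ▸ right_mem_segment ℝ _ _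
  exact Δ.ori_ne_zero ((Δ.edge12_iff _).1 this).2

theorem edge12_ne_31 : segment ℝ Δ.x1 Δ.x2 ≠ segment ℝ Δ.x3 Δ.x1 := fun h => by
  have : Δ.x3 ∈ segment ℝ Δ.x1 Δ.x2 := h ▸ left_mem_segment ℝ _ _
  exact Δ.ori_ne_zero ((Δ.edge12_iff _).1 this).2

theorem edge23_ne_31 : segment ℝ Δ.x2 Δ.x3 ≠ segment ℝ Δ.x3 Δ.x1 := fun h => by
  have : Δ.x1 ∈ segment ℝ Δ.x2 Δ.x3 := h ▸ right_mem_segment ℝ _ _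
  have := ((Δ.edge23_iff _).1 this).2
  rw [ori23] at this
  exact Δ.ori_ne_zero this

theorem tri_convex : Convex ℝ Δ.tri := convex_convexHull _ _

/-- What is required of the equation of a segment of the arrangement. -/
def IsEqn (m : Set Pt) (k : ℝ × ℝ × ℝ) : Prop :=
  (k.1 ≠ 0 ∨ k.2.1 ≠ 0) ∧ (∀ q, q ∈ m ↔ q ∈ Δ.tri ∧ aff k q = 0) ∧
  (m = segment ℝ Δ.x1 Δ.x2 → ∀ q, aff k q = cross Δ.x1 Δ.x2 q * Δ.ori) ∧
  (m = segment ℝ Δ.x2 Δ.x3 → ∀ q, aff k q = cross Δ.x2 Δ.x3 q * Δ.ori) ∧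
  (m = segment ℝ Δ.x3 Δ.x1 → ∀ q, aff k q = cross Δ.x3 Δ.x1 q * Δ.ori)

theorem exists_eqn_edge {m : Set Pt} (hm : m ∈ triEdges Δ.x1 Δ.x2 Δ.x3) :
    ∃ k, Δ.IsEqn m k := by
  have ho := Δ.ori_ne_zero
  simp only [triEdges, mem_insert_iff, mem_singleton_iff] at hm
  rcases hm with rfl | rfl | rfl
  · obtain ⟨k, hk, hk'⟩ := cross_eq_aff Δ.x1 Δ.x2 Δ.ori
    refine ⟨k, hk' Δ.x12_ne ho, fun q => ?_, fun _ => hk,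
      fun h => absurd h Δ.edge12_ne_23, fun h => absurd h Δ.edge12_ne_31⟩
    rw [edge12_iff, hk]; simp [ho]
  · obtain ⟨k, hk, hk'⟩ := cross_eq_aff Δ.x2 Δ.x3 Δ.ori
    refine ⟨k, hk' Δ.x23_ne ho, fun q => ?_, fun h => absurd h.symm Δ.edge12_ne_23,
      fun _ => hk, fun h => absurd h Δ.edge23_ne_31⟩
    rw [edge23_iff, hk]; simp [ho]
  · obtain ⟨k, hk, hk'⟩ := cross_eq_aff Δ.x3 Δ.x1 Δ.ori
    refine ⟨k, hk' Δ.x31_ne ho, fun q => ?_, fun h => absurd h.symm Δ.edge12_ne_31,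
      fun h => absurd h.symm Δ.edge23_ne_31, fun _ => hk⟩
    rw [edge31_iff, hk]; simp [ho]

theorem IsEqn.nonneg {m : Set Pt} {k : ℝ × ℝ × ℝ} (hk : Δ.IsEqn m k)
    (hm : m ∈ triEdges Δ.x1 Δ.x2 Δ.x3) {q : Pt} (hq : q ∈ Δ.tri) : 0 ≤ aff k q := by
  obtain ⟨h1, h2, h3⟩ := (Δ.mem_tri_iff q).1 hq
  simp only [triEdges, mem_insert_iff, mem_singleton_iff] at hm
  rcases hm with h | h | h
  · rwa [hk.2.2.1 h]
  · rwa [hk.2.2.2.1 h]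
  · rwa [hk.2.2.2.2 h]

theorem mem_triBdry {x1 x2 x3 q : Pt} :
    q ∈ triBdry x1 x2 x3 ↔ ∃ e ∈ triEdges x1 x2 x3, q ∈ e := by
  simp [triBdry, triEdges, or_assoc]

theorem bdry_subset_tri : triBdry Δ.x1 Δ.x2 Δ.x3 ⊆ Δ.tri := by
  intro q hq
  rcases hq with (h | h) | h
  · exact ((Δ.edge12_iff q).1 h).1
  · exact ((Δ.edge23_iff q).1 h).1
  · exact ((Δ.edge31_iff q).1 h).1

/-- A chord with an endpoint `b` on the boundary cannot be prolonged beyond `b` in `T`. -/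
theorem chord_not_beyond {a b : Pt} (ha : a ∈ Δ.tri)
    (hb : b ∈ triBdry Δ.x1 Δ.x2 Δ.x3)
    (hopen : ∀ p ∈ openSegment ℝ a b, p ∉ triBdry Δ.x1 Δ.x2 Δ.x3) {t : ℝ}
    (hq : a + t • (b - a) ∈ Δ.tri) : t ≤ 1 := by
  by_contra! ht
  obtain ⟨e, he, hbe⟩ := mem_triBdry.1 hb
  obtain ⟨k, hk⟩ := Δ.exists_eqn_edge he
  have h1 := hk.nonneg Δ he ha
  have h2 := hk.nonneg Δ he hq
  have h3 := ((hk.2.1 b).1 hbe).2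
  rw [aff_ray, h3] at h2
  have h4 : aff k a = 0 := by nlinarith
  have hm : (1 / 2 : ℝ) • a + (1 / 2 : ℝ) • b ∈ openSegment ℝ a b :=
    ⟨1 / 2, 1 / 2, by norm_num, by norm_num, by norm_num, rfl⟩
  refine hopen _ hm (mem_triBdry.2 ⟨e, he, (hk.2.1 _).2 ⟨?_, ?_⟩⟩)
  · exact Δ.tri_convex ha (Δ.bdry_subset_tri hb) (by norm_num) (by norm_num) (by norm_num)
  · rw [aff_comb k a b (by norm_num), h3, h4]; ring

theorem exists_eqn {m : Set Pt} (hm : m ∈ Δ.Sbar ∪ Δ.B) : ∃ k, Δ.IsEqn m k := by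
  by_cases he : m ∈ triEdges Δ.x1 Δ.x2 Δ.x3
  · exact Δ.exists_eqn_edge he
  have hm' : m ∈ Δ.S ∪ Δ.B := by
    rcases hm with (h | h) | h
    · exact Or.inl h
    · exact absurd h he
    · exact Or.inr h
  obtain ⟨a, b, hab, rfl, ha, hb, hopen⟩ := Δ.seg_wf m hm'
  obtain ⟨k, hk, hk'⟩ := cross_eq_aff a b 1
  have haT := Δ.bdry_subset_tri ha
  have hbT := Δ.bdry_subset_tri hb
  refine ⟨k, hk' hab one_ne_zero, fun q => ⟨?_, ?_⟩, fun h => ?_, fun h => ?_, fun h => ?_⟩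
  · intro hq
    refine ⟨Δ.tri_convex.segment_subset haT hbT hq, ?_⟩
    obtain ⟨s, t, hs, ht, hst, rfl⟩ := hq
    rw [aff_comb k a b hst, hk, hk]
    simp only [cross]; ring
  · rintro ⟨hq, h0⟩
    rw [hk, mul_one] at h0
    obtain ⟨t, rfl⟩ := exists_of_cross_eq_zero hab h0
    have h1 := Δ.chord_not_beyond haT hb hopen hq
    have h2 := Δ.chord_not_beyond (a := b) (b := a) (t := 1 - t) hbT ha
      (by rwa [openSegment_symm]) (by convert hq using 1; ext <;> simp <;> ring)
    refine ⟨1 - t, t, by linarith, by linarith, by ring, ?_⟩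
    ext <;> simp <;> ring
  · exact absurd (by simp [triEdges, h]) he
  · exact absurd (by simp [triEdges, h]) he
  · exact absurd (by simp [triEdges, h]) he

open Classical in
/-- Coefficients of an equation of the line through a segment of the arrangement. -/
def eqn (m : Set Pt) : ℝ × ℝ × ℝ := if h : ∃ k, Δ.IsEqn m k then h.choose else 0

/-- The chosen affine functional vanishing on the line through a segment. -/
def fn (m : Set Pt) (q : Pt) : ℝ := aff (Δ.eqn m) q

variable {Δ}

theorem isEqn {m : Set Pt} (hm : m ∈ Δ.Sbar ∪ Δ.B) : Δ.IsEqn m (Δ.eqn m) := by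
  rw [eqn, dif_pos (Δ.exists_eqn hm)]
  exact (Δ.exists_eqn hm).choose_spec

theorem fn_comb (m : Set Pt) (x y : Pt) {a b : ℝ} (h : a + b = 1) :
    Δ.fn m (a • x + b • y) = a * Δ.fn m x + b * Δ.fn m y := aff_comb _ x y h

theorem fn_ray (m : Set Pt) (x y : Pt) (t : ℝ) :
    Δ.fn m (x + t • (y - x)) = Δ.fn m x + t * (Δ.fn m y - Δ.fn m x) := aff_ray _ x y t

theorem fn_continuous (m : Set Pt) : Continuous (Δ.fn m) := aff_continuous _

theorem mem_iff {m : Set Pt} (hm : m ∈ Δ.Sbar ∪ Δ.B) {q : Pt} :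
    q ∈ m ↔ q ∈ Δ.tri ∧ Δ.fn m q = 0 := (isEqn hm).2.1 q

theorem fn_edge_nonneg {m : Set Pt} (hm : m ∈ triEdges Δ.x1 Δ.x2 Δ.x3) {q : Pt}
    (hq : q ∈ Δ.tri) : 0 ≤ Δ.fn m q := (isEqn (Or.inl (Or.inr hm))).nonneg Δ hm hq

theorem mem_tri_of_edges {q : Pt} (h : ∀ e ∈ triEdges Δ.x1 Δ.x2 Δ.x3, 0 ≤ Δ.fn e q) :
    q ∈ Δ.tri := by
  have h1 : segment ℝ Δ.x1 Δ.x2 ∈ triEdges Δ.x1 Δ.x2 Δ.x3 := by simp [triEdges]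
  have h2 : segment ℝ Δ.x2 Δ.x3 ∈ triEdges Δ.x1 Δ.x2 Δ.x3 := by simp [triEdges]
  have h3 : segment ℝ Δ.x3 Δ.x1 ∈ triEdges Δ.x1 Δ.x2 Δ.x3 := by simp [triEdges]
  rw [mem_tri_iff]
  refine ⟨?_, ?_, ?_⟩
  · rw [← (isEqn (Or.inl (Or.inr h1))).2.2.1 rfl]; exact h _ h1
  · rw [← (isEqn (Or.inl (Or.inr h2))).2.2.2.1 rfl]; exact h _ h2
  · rw [← (isEqn (Or.inl (Or.inr h3))).2.2.2.2 rfl]; exact h _ h3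

theorem fn_ne {m : Set Pt} (hm : m ∈ Δ.Sbar ∪ Δ.B) {q : Pt} (hq : q ∈ Δ.tri) (h : q ∉ m) :
    Δ.fn m q ≠ 0 := fun h0 => h ((mem_iff hm).2 ⟨hq, h0⟩)

theorem fn_eq_zero {m : Set Pt} (hm : m ∈ Δ.Sbar ∪ Δ.B) {q : Pt} (hq : q ∈ m) :
    Δ.fn m q = 0 := ((mem_iff hm).1 hq).2

theorem mem_tri {m : Set Pt} (hm : m ∈ Δ.Sbar ∪ Δ.B) {q : Pt} (hq : q ∈ m) :
    q ∈ Δ.tri := ((mem_iff hm).1 hq).1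

theorem cross_of_mem {m : Set Pt} (hm : m ∈ Δ.Sbar ∪ Δ.B) {p q r : Pt} (hp : p ∈ m)
    (hq : q ∈ m) (hr : r ∈ m) : cross p q r = 0 := by
  have h1 := fn_eq_zero hm hp
  have h2 := fn_eq_zero hm hq
  have h3 := fn_eq_zero hm hr
  have hnd := (isEqn hm).1
  simp only [fn, aff] at h1 h2 h3
  simp only [cross]
  rcases hnd with h | h
  · apply mul_left_cancel₀ h
    linear_combination (q.2 - p.2) * (h1 - h3) - (r.2 - p.2) * (h1 - h2)
  · apply mul_left_cancel₀ h
    linear_combination (q.1 - p.1) * (h3 - h1) - (r.1 - p.1) * (h2 - h1)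

theorem exists_ray {m : Set Pt} (hm : m ∈ Δ.Sbar ∪ Δ.B) {p q r : Pt} (hpq : p ≠ q)
    (hp : p ∈ m) (hq : q ∈ m) (hr : r ∈ m) : ∃ t : ℝ, r = p + t • (q - p) :=
  exists_of_cross_eq_zero hpq (cross_of_mem hm hp hq hr)

/-- Two segments of the arrangement sharing two points coincide. -/
theorem eq_of_two {m m' : Set Pt} (hm : m ∈ Δ.Sbar ∪ Δ.B) (hm' : m' ∈ Δ.Sbar ∪ Δ.B)
    {p q : Pt} (hpq : p ≠ q) (hp : p ∈ m) (hq : q ∈ m) (hp' : p ∈ m') (hq' : q ∈ m') :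
    m = m' := by
  have key : ∀ {m m' : Set Pt}, m ∈ Δ.Sbar ∪ Δ.B → m' ∈ Δ.Sbar ∪ Δ.B → p ∈ m → q ∈ m →
      p ∈ m' → q ∈ m' → m ⊆ m' := by
    intro m m' hm hm' hp hq hp' hq' r hr
    obtain ⟨t, rfl⟩ := exists_ray hm hpq hp hq hr
    exact (mem_iff hm').2 ⟨mem_tri hm hr, by
      rw [fn_ray, fn_eq_zero hm' hp', fn_eq_zero hm' hq']; ring⟩
  exact Subset.antisymm (key hm hm' hp hq hp' hq') (key hm' hm hp' hq' hp hq)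

theorem exists_two {m : Set Pt} (hm : m ∈ Δ.Sbar ∪ Δ.B) : ∃ a b : Pt, a ≠ b ∧
    m = segment ℝ a b := by
  by_cases he : m ∈ triEdges Δ.x1 Δ.x2 Δ.x3
  · simp only [triEdges, mem_insert_iff, mem_singleton_iff] at he
    rcases he with h | h | h
    exacts [⟨_, _, Δ.x12_ne, h⟩, ⟨_, _, Δ.x23_ne, h⟩, ⟨_, _, Δ.x31_ne, h⟩]
  · have hm' : m ∈ Δ.S ∪ Δ.B := by
      rcases hm with (h | h) | h
      · exact Or.inl h
      · exact absurd h he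
      · exact Or.inr h
    obtain ⟨a, b, hab, h, -⟩ := Δ.seg_wf m hm'
    exact ⟨a, b, hab, h⟩

theorem exists_ne_mem {m : Set Pt} (hm : m ∈ Δ.Sbar ∪ Δ.B) (v : Pt) : ∃ p ∈ m, p ≠ v := by
  obtain ⟨a, b, hab, rfl⟩ := exists_two hm
  by_cases h : a = v
  · exact ⟨b, right_mem_segment ℝ _ _, fun h' => hab (h.trans h'.symm)⟩
  · exact ⟨a, left_mem_segment ℝ _ _, h⟩

/-- An affine functional vanishing at the crossing of two segments is a linear
combination of their equations. -/
theorem lin {m m' : Set Pt} (hm : m ∈ Δ.Sbar ∪ Δ.B) (hm' : m' ∈ Δ.Sbar ∪ Δ.B) (hne : m ≠ m')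
    {v : Pt} (hv : v ∈ m) (hv' : v ∈ m') {n : Set Pt} (hn : Δ.fn n v = 0) :
    ∃ a b : ℝ, ∀ q, Δ.fn n q = a * Δ.fn m q + b * Δ.fn m' q := by
  have h1 := fn_eq_zero hm hv
  have h2 := fn_eq_zero hm' hv'
  obtain ⟨p, hp, hpv⟩ := exists_ne_mem hm v
  have h3 := fn_eq_zero hm hp
  have h4 : Δ.fn m' p ≠ 0 := fn_ne hm' (mem_tri hm hp) fun h => hne
    (eq_of_two hm hm' hpv hp hv h hv')
  simp only [fn, aff] at h1 h2 h3 h4 hn ⊢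
  set k := Δ.eqn m
  set k' := Δ.eqn m'
  set j := Δ.eqn n
  have hnd : k.1 ≠ 0 ∨ k.2.1 ≠ 0 := (isEqn hm).1
  have hdet : k.1 * k'.2.1 - k.2.1 * k'.1 ≠ 0 := by
    intro h0
    apply h4
    rcases hnd with h | h
    · apply mul_left_cancel₀ h
      linear_combination k.1 * h2 + k'.1 * (h3 - h1) + (p.2 - v.2) * h0
    · apply mul_left_cancel₀ h
      linear_combination k.2.1 * h2 + k'.2.1 * (h3 - h1) - (p.1 - v.1) * h0
  refine ⟨(j.1 * k'.2.1 - j.2.1 * k'.1) / (k.1 * k'.2.1 - k.2.1 * k'.1),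
    (k.1 * j.2.1 - k.2.1 * j.1) / (k.1 * k'.2.1 - k.2.1 * k'.1), fun q => ?_⟩
  rw [div_mul_eq_mul_div, div_mul_eq_mul_div, ← add_div, eq_div_iff hdet]
  linear_combination (k.1 * k'.2.1 - k.2.1 * k'.1) * hn -
    (j.1 * k'.2.1 - j.2.1 * k'.1) * h1 - (k.1 * j.2.1 - k.2.1 * j.1) * h2

end TBA

namespace TBA

/-! ### Sides of segments -/

/-- The points `x` and `y` lie strictly on opposite sides of the line through `m`. -/
def Opp (Δ : TBA) (m : Set Pt) (x y : Pt) : Prop := Δ.fn m x * Δ.fn m y < 0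

/-- The points `x` and `y` lie strictly on the same side of the line through `m`. -/
def Sm (Δ : TBA) (m : Set Pt) (x y : Pt) : Prop := 0 < Δ.fn m x * Δ.fn m y

variable {Δ : TBA} {m m' : Set Pt} {x y z p q v : Pt}

theorem opp_iff : Δ.Opp m x y ↔
    (0 < Δ.fn m x ∧ Δ.fn m y < 0) ∨ (Δ.fn m x < 0 ∧ 0 < Δ.fn m y) := mul_neg_iff

theorem sm_iff : Δ.Sm m x y ↔
    (0 < Δ.fn m x ∧ 0 < Δ.fn m y) ∨ (Δ.fn m x < 0 ∧ Δ.fn m y < 0) := mul_pos_iff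

theorem Opp.symm (h : Δ.Opp m x y) : Δ.Opp m y x := by rw [Opp, mul_comm]; exact h
theorem Sm.symm (h : Δ.Sm m x y) : Δ.Sm m y x := by rw [Sm, mul_comm]; exact h

theorem Opp.trans (h : Δ.Opp m x y) (h' : Δ.Opp m y z) : Δ.Sm m x z := by
  rw [opp_iff] at *; rw [sm_iff]; grind
theorem Opp.sm (h : Δ.Opp m x y) (h' : Δ.Sm m y z) : Δ.Opp m x z := by
  rw [opp_iff] at *; rw [sm_iff] at *; grind
theorem Sm.opp (h : Δ.Sm m x y) (h' : Δ.Opp m y z) : Δ.Opp m x z := by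
  rw [opp_iff] at *; rw [sm_iff] at *; grind
theorem Sm.trans (h : Δ.Sm m x y) (h' : Δ.Sm m y z) : Δ.Sm m x z := by
  rw [sm_iff] at *; grind
theorem Opp.not_sm (h : Δ.Opp m x y) : ¬ Δ.Sm m x y := not_lt.2 h.le
theorem Sm.not_opp (h : Δ.Sm m x y) : ¬ Δ.Opp m x y := not_lt.2 h.le
theorem Opp.left (h : Δ.Opp m x y) : Δ.fn m x ≠ 0 := left_ne_zero_of_mul h.ne
theorem Opp.right (h : Δ.Opp m x y) : Δ.fn m y ≠ 0 := right_ne_zero_of_mul h.ne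
theorem Sm.left (h : Δ.Sm m x y) : Δ.fn m x ≠ 0 := left_ne_zero_of_mul h.ne'
theorem Sm.right (h : Δ.Sm m x y) : Δ.fn m y ≠ 0 := right_ne_zero_of_mul h.ne'
theorem sm_refl (h : Δ.fn m x ≠ 0) : Δ.Sm m x x := mul_self_pos.2 h
theorem not_opp_self : ¬ Δ.Opp m x x := not_lt.2 (mul_self_nonneg _)
theorem Opp.ne (h : Δ.Opp m x y) : x ≠ y := by rintro rfl; exact not_opp_self h
theorem opp_or_sm (hx : Δ.fn m x ≠ 0) (hy : Δ.fn m y ≠ 0) : Δ.Opp m x y ∨ Δ.Sm m x y :=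
  (mul_ne_zero hx hy).lt_or_gt
theorem sm_of_not_opp (hx : Δ.fn m x ≠ 0) (hy : Δ.fn m y ≠ 0) (h : ¬ Δ.Opp m x y) :
    Δ.Sm m x y := (opp_or_sm hx hy).resolve_left h
theorem opp_of_not_sm (hx : Δ.fn m x ≠ 0) (hy : Δ.fn m y ≠ 0) (h : ¬ Δ.Sm m x y) :
    Δ.Opp m x y := (opp_or_sm hx hy).resolve_right h
theorem Opp.split (h : Δ.Opp m x y) (hz : Δ.fn m z ≠ 0) : Δ.Opp m x z ∨ Δ.Opp m z y := by
  rcases opp_or_sm h.left hz with h1 | h1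
  · exact Or.inl h1
  · exact Or.inr (h1.symm.opp h)

theorem mid_val (hq : q ∈ openSegment ℝ x y) : ∃ a b : ℝ, 0 < a ∧ 0 < b ∧ a + b = 1 ∧
    ∀ m, Δ.fn m q = a * Δ.fn m x + b * Δ.fn m y := by
  obtain ⟨a, b, ha, hb, hab, rfl⟩ := hq
  exact ⟨a, b, ha, hb, hab, fun m => fn_comb m x y hab⟩

theorem mid_symm (hq : q ∈ openSegment ℝ x y) : q ∈ openSegment ℝ y x := by
  rwa [openSegment_symm]

theorem mid_tri (hq : q ∈ openSegment ℝ x y) (hx : x ∈ Δ.tri) (hy : y ∈ Δ.tri) : q ∈ Δ.tri :=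
  Δ.tri_convex.openSegment_subset hx hy hq

theorem mid_zero (hq : q ∈ openSegment ℝ x y) (hx : Δ.fn m x = 0) (hy : Δ.fn m y = 0) :
    Δ.fn m q = 0 := by
  obtain ⟨a, b, -, -, -, h⟩ := mid_val (Δ := Δ) hq
  rw [h, hx, hy]; ring

theorem mid_mem (hm : m ∈ Δ.Sbar ∪ Δ.B) (hq : q ∈ openSegment ℝ x y) (hx : x ∈ m)
    (hy : y ∈ m) : q ∈ m :=
  (mem_iff hm).2 ⟨mid_tri hq (mem_tri hm hx) (mem_tri hm hy),
    mid_zero hq (fn_eq_zero hm hx) (fn_eq_zero hm hy)⟩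

theorem mid_opp (hq : q ∈ openSegment ℝ x y) (h : Δ.fn m q = 0) (hx : Δ.fn m x ≠ 0) :
    Δ.Opp m x y := by
  obtain ⟨a, b, ha, hb, -, hm⟩ := mid_val (Δ := Δ) hq
  have h2 : Δ.fn m y = -(a / b) * Δ.fn m x := by
    field_simp; linarith [hm m]
  rw [Opp, h2, show Δ.fn m x * (-(a / b) * Δ.fn m x) =
    -((a / b) * (Δ.fn m x * Δ.fn m x)) by ring]
  have := mul_self_pos.2 hx
  have : 0 < a / b := by positivity
  have := mul_pos this (mul_self_pos.2 hx)
  linarith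

theorem mid_sm_right (hq : q ∈ openSegment ℝ x y) (hx : Δ.fn m x = 0) (hy : Δ.fn m y ≠ 0) :
    Δ.Sm m q y := by
  obtain ⟨a, b, ha, hb, -, hm⟩ := mid_val (Δ := Δ) hq
  rw [Sm, hm, hx, mul_zero, zero_add, mul_assoc]
  exact mul_pos hb (mul_self_pos.2 hy)

theorem mid_sm_left (hq : q ∈ openSegment ℝ x y) (hy : Δ.fn m y = 0) (hx : Δ.fn m x ≠ 0) :
    Δ.Sm m q x := mid_sm_right (mid_symm hq) hy hx

theorem mid_sm (hq : q ∈ openSegment ℝ x y) (h : Δ.Sm m x y) : Δ.Sm m q x := by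
  obtain ⟨a, b, ha, hb, -, hm⟩ := mid_val (Δ := Δ) hq
  have h1 := mul_pos hb h
  have h2 := mul_pos ha (mul_self_pos.2 h.left)
  rw [Sm, hm]; linarith

theorem mid_opp_left (hq : q ∈ openSegment ℝ x y) (h : Δ.Opp m x q) : Δ.Sm m q y := by
  obtain ⟨a, b, ha, hb, -, hm⟩ := mid_val (Δ := Δ) hq
  by_cases h0 : Δ.fn m y = 0
  · exact absurd h.symm (mid_sm_left hq h0 h.left).not_opp
  · by_contra hcon
    have h1 := (opp_of_not_sm h.right h0 hcon)
    exact absurd h ((mid_sm hq (h.trans h1)).symm.not_opp)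

theorem mid_opp_right (hq : q ∈ openSegment ℝ x y) (h : Δ.Opp m q y) : Δ.Sm m q x :=
  mid_opp_left (mid_symm hq) h.symm

theorem exists_mid (h : Δ.Opp m x y) : ∃ q ∈ openSegment ℝ x y, Δ.fn m q = 0 := by
  have hne : Δ.fn m x - Δ.fn m y ≠ 0 := by
    intro h0
    rw [Opp, show Δ.fn m x = Δ.fn m y by linarith] at h
    exact absurd h (not_lt.2 (mul_self_nonneg _))
  have h1 : 0 < -Δ.fn m y / (Δ.fn m x - Δ.fn m y) := by
    rcases opp_iff.1 h with ⟨h1, h2⟩ | ⟨h1, h2⟩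
    · exact div_pos (by linarith) (by linarith)
    · exact div_pos_of_neg_of_neg (by linarith) (by linarith)
  have h2 : 0 < Δ.fn m x / (Δ.fn m x - Δ.fn m y) := by
    rcases opp_iff.1 h with ⟨h1, h2⟩ | ⟨h1, h2⟩
    · exact div_pos (by linarith) (by linarith)
    · exact div_pos_of_neg_of_neg (by linarith) (by linarith)
  have h3 : -Δ.fn m y / (Δ.fn m x - Δ.fn m y) + Δ.fn m x / (Δ.fn m x - Δ.fn m y) = 1 := by
    field_simp; ring
  refine ⟨_, ⟨_, _, h1, h2, h3, rfl⟩, ?_⟩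
  rw [fn_comb m x y h3]; field_simp; ring

theorem exists_cross (hm : m ∈ Δ.Sbar ∪ Δ.B) (h : Δ.Opp m x y) (hx : x ∈ Δ.tri)
    (hy : y ∈ Δ.tri) : ∃ q ∈ openSegment ℝ x y, q ∈ m := by
  obtain ⟨q, hq, h0⟩ := exists_mid h
  exact ⟨q, hq, (mem_iff hm).2 ⟨mid_tri hq hx hy, h0⟩⟩

/-- If `d` and `r` on the segment `m` lie on the same side of `y ∈ m`, as witnessed by `m'`,
then they are on the same side of `y` for every segment through `y`. -/
theorem ray_sm (hm : m ∈ Δ.Sbar ∪ Δ.B) (hy : y ∈ m) (hr : p ∈ m) (hd : q ∈ m)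
    (h0 : Δ.fn m' y = 0) (h : Δ.Sm m' p q) {n : Set Pt} (hn : Δ.fn n y = 0)
    (hnq : Δ.fn n q ≠ 0) : Δ.Sm n p q := by
  have hyd : y ≠ q := by rintro rfl; exact h.right h0
  obtain ⟨t, rfl⟩ := exists_ray hm hyd hy hd hr
  rw [Sm, fn_ray, h0] at h
  rw [Sm, fn_ray, hn]
  have h1 := mul_self_pos.2 hnq
  have ht : 0 < t := by
    by_contra! ht
    have := mul_self_nonneg (Δ.fn m' q)
    nlinarith
  have := mul_pos ht h1
  linarith

/-- A point of `m` strictly between two others, as seen by a transversal. -/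
theorem mid_of_opp (hm : m ∈ Δ.Sbar ∪ Δ.B) (hx : x ∈ m) (hy : y ∈ m) (hq : q ∈ m)
    (h0 : Δ.fn m' q = 0) (h : Δ.Opp m' x y) : q ∈ openSegment ℝ x y := by
  obtain ⟨t, rfl⟩ := exists_ray hm h.ne hx hy hq
  rw [fn_ray] at h0
  have key : t * Δ.fn m' y = -(1 - t) * Δ.fn m' x := by linarith
  have h1 := h
  rw [Opp] at h1
  have hx0 := mul_self_pos.2 h.left
  have hy0 := mul_self_pos.2 h.right
  have ht : 0 < t := by
    by_contra! ht
    have : t * (Δ.fn m' y * Δ.fn m' y) = -(1 - t) * (Δ.fn m' x * Δ.fn m' y) := by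
      linear_combination Δ.fn m' y * key
    nlinarith
  have ht1 : t < 1 := by
    by_contra! ht1
    have : t * (Δ.fn m' x * Δ.fn m' y) = -(1 - t) * (Δ.fn m' x * Δ.fn m' x) := by
      linear_combination Δ.fn m' x * key
    nlinarith
  refine ⟨1 - t, t, by linarith, ht, by ring, ?_⟩
  ext <;> simp <;> ring

/-! ### Incidences -/

variable {s s' s₁ s₂ s₃ b b' e : Set Pt} {p₀ : Pt}

theorem S_sub (hs : s ∈ Δ.S) : s ∈ Δ.Sbar := Or.inl hs

theorem finSbar : Δ.Sbar.Finite := by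
  refine Δ.finS.union ?_
  simp [triEdges]

theorem conc (h₁ : s₁ ∈ Δ.Sbar) (h₂ : s₂ ∈ Δ.Sbar) (h₃ : s₃ ∈ Δ.Sbar) (h₁₂ : s₁ ≠ s₂)
    (h₁₃ : s₁ ≠ s₃) (h₂₃ : s₂ ≠ s₃) (hp₁ : p ∈ s₁) (hp₂ : p ∈ s₂) (hp₃ : p ∈ s₃) : False :=
  Δ.no_three_concurrent s₁ h₁ s₂ h₂ s₃ h₃ h₁₂ h₁₃ h₂₃ ⟨p, hp₁, hp₂, hp₃⟩

theorem second (hs : s ∈ Δ.Sbar) (hb : b ∈ Δ.B) (hp : p ∈ s) (hpb : p ∈ b) :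
    ∃ s' ∈ Δ.Sbar, s' ≠ s ∧ p ∈ s' := by
  obtain ⟨s', ⟨h1, h2, h3⟩, -⟩ := Δ.second_segment s hs b hb p hp hpb
  exact ⟨s', h1, h2, h3⟩

theorem opp_not_edge (hx : x ∈ Δ.tri) (hy : y ∈ Δ.tri) (h : Δ.Opp m x y) :
    m ∉ triEdges Δ.x1 Δ.x2 Δ.x3 := fun hm =>
  not_le.2 h (mul_nonneg (fn_edge_nonneg hm hx) (fn_edge_nonneg hm hy))

theorem opp_mem_S (hm : m ∈ Δ.Sbar) (hx : x ∈ Δ.tri) (hy : y ∈ Δ.tri) (h : Δ.Opp m x y) :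
    m ∈ Δ.S := hm.resolve_right (opp_not_edge hx hy h)

theorem S_not_edge (hs : s ∈ Δ.S) : s ∉ triEdges Δ.x1 Δ.x2 Δ.x3 := by
  intro he
  obtain ⟨a, b, -, rfl, -, -, h⟩ := Δ.seg_wf s (Or.inl hs)
  have hm : (1 / 2 : ℝ) • a + (1 / 2 : ℝ) • b ∈ openSegment ℝ a b :=
    ⟨1 / 2, 1 / 2, by norm_num, by norm_num, by norm_num, rfl⟩
  exact h _ hm (mem_triBdry.2 ⟨_, he, openSegment_subset_segment _ _ _ hm⟩)

theorem exists_block (hs : s ∈ Δ.S) (hs' : s' ∈ Δ.Sbar) (hne : s ≠ s') (hp : p ∈ s)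
    (hp' : p ∈ s') : ∃ b ∈ Δ.B, p ∈ b := by
  obtain ⟨b, ⟨h1, h2⟩, -⟩ := Δ.block_exists s (S_sub hs) s' hs' hne
    (fun h => S_not_edge hs h.1) p hp hp'
  exact ⟨b, h1, h2⟩

theorem block_eq (hs : s ∈ Δ.Sbar) (hs' : s' ∈ Δ.Sbar) (hne : s ≠ s') (hp : p ∈ s)
    (hp' : p ∈ s') (hb : b ∈ Δ.B) (hb' : b' ∈ Δ.B) (hpb : p ∈ b) (hpb' : p ∈ b') : b = b' :=
  Δ.block_unique s hs s' hs' hne p hp hp' b hb b' hb' hpb hpb'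

theorem infinite_of_mem (hm : m ∈ Δ.Sbar ∪ Δ.B) : m.Infinite := by
  obtain ⟨a, b, hab, rfl⟩ := exists_two hm
  refine Set.infinite_of_injective_forall_mem (f := fun n : ℕ => a + (1 / (n + 1 : ℝ)) • (b - a))
    (fun i j hij => ?_) (fun n => ?_)
  · have h1 : (1 / (i + 1 : ℝ)) • (b - a) = (1 / (j + 1 : ℝ)) • (b - a) := add_left_cancel hij
    have h2 := smul_left_injective ℝ (sub_ne_zero.2 hab.symm) h1
    have h3 : (i : ℝ) + 1 = j + 1 := by
      have := congrArg (fun t : ℝ => 1 / t) h2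
      simpa using this
    exact_mod_cast add_right_cancel h3
  · rw [segment_eq_image']
    refine ⟨1 / (n + 1 : ℝ), ⟨by positivity, ?_⟩, rfl⟩
    rw [div_le_one (by positivity)]
    have : (0 : ℝ) ≤ n := by positivity
    linarith

theorem B_ne (hb : b ∈ Δ.B) (hs : s ∈ Δ.Sbar) : b ≠ s := by
  rintro rfl
  refine infinite_of_mem (Or.inr hb) (Set.Finite.subset (s := ⋃ s' ∈ Δ.Sbar \ {b}, b ∩ s') ?_ ?_)
  · refine Set.Finite.biUnion (finSbar.sdiff) (fun s' hs' => Set.Subsingleton.finite ?_)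
    intro p hp q hq
    by_contra hpq
    exact hs'.2 (eq_of_two (Or.inl hs'.1) (Or.inl hs) hpq hp.2 hq.2 hp.1 hq.1)
  · intro p hp
    obtain ⟨s', h1, h2, h3⟩ := second hs hb hp hp
    simp only [mem_iUnion]
    exact ⟨s', ⟨h1, h2⟩, hp, h3⟩

/-- Two distinct segments meet at most once. -/
theorem meet_eq (hm : m ∈ Δ.Sbar ∪ Δ.B) (hm' : m' ∈ Δ.Sbar ∪ Δ.B) (hne : m ≠ m') (hp : p ∈ m)
    (hp' : p ∈ m') (hq : q ∈ m) (hq' : q ∈ m') : p = q := by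
  by_contra h
  exact hne (eq_of_two hm hm' h hp hq hp' hq')

theorem not_mem_of_meet (hm : m ∈ Δ.Sbar ∪ Δ.B) (hm' : m' ∈ Δ.Sbar ∪ Δ.B) (hne : m ≠ m')
    (hp : p ∈ m) (hp' : p ∈ m') (hq : q ∈ m) (hqp : q ≠ p) : Δ.fn m' q ≠ 0 :=
  fn_ne hm' (mem_tri hm hq) fun h => hqp (meet_eq hm hm' hne hq h hp hp')

open Filter Topology in
theorem eventually_pos {c : ℝ} (h : 0 < c * Δ.fn m x) (y : Pt) :
    ∀ᶠ t in 𝓝[>] (0 : ℝ), 0 < c * Δ.fn m (x + t • (y - x)) := by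
  have hc : Continuous fun t : ℝ => c * Δ.fn m (x + t • (y - x)) := by
    simp only [fn_ray]; fun_prop
  refine (hc.tendsto 0).eventually (lt_mem_nhds ?_) |>.filter_mono nhdsWithin_le_nhds
  simpa using h

/-- A segment through an interior point `x` of `T` continues beyond `x`. -/
theorem exists_beyond (hm : m ∈ Δ.Sbar ∪ Δ.B) (hx : x ∈ m) (hp : p ∈ m)
    (hin : ∀ e ∈ triEdges Δ.x1 Δ.x2 Δ.x3, x ∉ e) : ∃ q ∈ m, x ∈ openSegment ℝ p q := by
  have hT := mem_tri hm hx
  have h1 : ∀ e ∈ triEdges Δ.x1 Δ.x2 Δ.x3, 0 < 1 * Δ.fn e x := fun e he => by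
    rw [one_mul]
    exact lt_of_le_of_ne (fn_edge_nonneg he hT) (fn_ne (Or.inl (Or.inr he)) hT (hin e he)).symm
  have hfin : (triEdges Δ.x1 Δ.x2 Δ.x3).Finite := by simp [triEdges]
  have h2 := (Filter.eventually_all_finite hfin).2 fun e he =>
    eventually_pos (h1 e he) (x + (-1 : ℝ) • (p - x))
  obtain ⟨t, ht, ht0⟩ := (h2.and self_mem_nhdsWithin).exists
  have ht0 : 0 < t := ht0
  refine ⟨x + t • (x + (-1 : ℝ) • (p - x) - x),
    (mem_iff hm).2 ⟨mem_tri_of_edges fun e he => ?_, ?_⟩, ?_⟩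
  · have := ht e he
    rw [one_mul] at this
    exact this.le
  · rw [fn_ray, fn_ray, fn_eq_zero hm hx, fn_eq_zero hm hp]; ring
  · refine ⟨t / (1 + t), 1 / (1 + t), by positivity, by positivity, by field_simp; ring, ?_⟩
    ext
    · simp; field_simp; ring
    · simp; field_simp; ring

theorem not_on_edge (h₁ : s₁ ∈ Δ.S) (h₂ : s₂ ∈ Δ.S) (hne : s₁ ≠ s₂) (hp₁ : p ∈ s₁)
    (hp₂ : p ∈ s₂) : ∀ e ∈ triEdges Δ.x1 Δ.x2 Δ.x3, p ∉ e := fun _ he hpe =>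
  conc (S_sub h₁) (S_sub h₂) (Or.inr he) hne (fun h => S_not_edge h₁ (h ▸ he))
    (fun h => S_not_edge h₂ (h ▸ he)) hp₁ hp₂ hpe

end TBA

namespace TBA

/-! ### Minimal regions -/

/-- The closed cell of the point `p₀`. -/
def cell (Δ : TBA) (p₀ : Pt) : Set Pt := {q | ∀ s ∈ Δ.Sbar, 0 ≤ Δ.fn s p₀ * Δ.fn s q}

/-- The open cell of the point `p₀`. -/
def openCell (Δ : TBA) (p₀ : Pt) : Set Pt := {q | ∀ s ∈ Δ.Sbar, Δ.Sm s p₀ q}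

/-- The point `p₀` of `T` lies on no initial segment. -/
def Generic (Δ : TBA) (p₀ : Pt) : Prop := p₀ ∈ Δ.tri ∧ ∀ s ∈ Δ.Sbar, Δ.fn s p₀ ≠ 0

variable {Δ : TBA} {m m' s s' s₂ s₄ b : Set Pt} {x y z p q u v p₀ v₂ v₃ v₄ : Pt}

theorem cell_subset_tri (h : Δ.Generic p₀) : Δ.cell p₀ ⊆ Δ.tri := fun q hq =>
  mem_tri_of_edges fun e he => by
    have h1 := hq e (Or.inr he)
    have h2 := lt_of_le_of_ne (fn_edge_nonneg he h.1) (h.2 e (Or.inr he)).symm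
    exact nonneg_of_mul_nonneg_right h1 h2

theorem openCell_subset_cell : Δ.openCell p₀ ⊆ Δ.cell p₀ := fun _ hq s hs => (hq s hs).le

theorem cell_closed : IsClosed (Δ.cell p₀) := by
  have : Δ.cell p₀ = ⋂ s ∈ Δ.Sbar, {q | 0 ≤ Δ.fn s p₀ * Δ.fn s q} := by
    ext q; simp [cell]
  rw [this]
  exact isClosed_biInter fun s _ =>
    isClosed_le continuous_const (continuous_const.mul (fn_continuous s))

theorem openCell_open : IsOpen (Δ.openCell p₀) := by
  have : Δ.openCell p₀ = ⋂ s ∈ Δ.Sbar, {q | 0 < Δ.fn s p₀ * Δ.fn s q} := by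
    ext q; simp [openCell, Sm]
  rw [this]
  exact finSbar.isOpen_biInter fun s _ =>
    isOpen_lt continuous_const (continuous_const.mul (fn_continuous s))

theorem mem_openCell (h : Δ.Generic p₀) : p₀ ∈ Δ.openCell p₀ := fun s hs => sm_refl (h.2 s hs)

theorem mem_interior_cell (h : Δ.Generic p₀) : p₀ ∈ interior (Δ.cell p₀) :=
  interior_maximal openCell_subset_cell openCell_open (mem_openCell h)

theorem cell_convex : Convex ℝ (Δ.cell p₀) := by
  intro x hx y hy a b ha hb hab s hs
  rw [fn_comb s x y hab]
  have h1 := mul_nonneg ha (hx s hs)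
  have h2 := mul_nonneg hb (hy s hs)
  linarith

theorem openCell_convex : Convex ℝ (Δ.openCell p₀) := by
  intro x hx y hy a b ha hb hab s hs
  rw [Sm, fn_comb s x y hab]
  have h1 : 0 < Δ.fn s p₀ * Δ.fn s x := hx s hs
  have h2 : 0 < Δ.fn s p₀ * Δ.fn s y := hy s hs
  rcases ha.eq_or_lt with rfl | ha'
  · obtain rfl : b = 1 := by linarith
    linarith
  · have := mul_pos ha' h1
    have := mul_nonneg hb h2.le
    linarith

theorem cell_subset_closure (h : Δ.Generic p₀) : Δ.cell p₀ ⊆ closure (Δ.openCell p₀) := by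
  intro q hq
  have h1 : openSegment ℝ p₀ q ⊆ Δ.openCell p₀ := by
    rintro _ ⟨a, b, ha, hb, hab, rfl⟩ s hs
    rw [Sm, fn_comb s _ _ hab]
    have h1 := mul_pos ha (mul_self_pos.2 (h.2 s hs))
    have h2 := mul_nonneg hb.le (hq s hs)
    linarith
  exact closure_mono h1 (segment_subset_closure_openSegment (right_mem_segment ℝ _ _))

theorem component_eq (h : Δ.Generic p₀) :
    connectedComponentIn (Δ.tri \ ⋃₀ Δ.Sbar) p₀ = Δ.openCell p₀ := by
  have hp : p₀ ∈ Δ.tri \ ⋃₀ Δ.Sbar := by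
    refine ⟨h.1, ?_⟩
    rintro ⟨s, hs, hps⟩
    exact h.2 s hs (fn_eq_zero (Or.inl hs) hps)
  apply Subset.antisymm
  · intro q hq s hs
    by_contra hcon
    have hc : IsPreconnected (connectedComponentIn (Δ.tri \ ⋃₀ Δ.Sbar) p₀) :=
      isPreconnected_connectedComponentIn
    have hmem := mem_connectedComponentIn hp
    obtain ⟨r, hr, hr0⟩ := hc.intermediate_value hq hmem
      (f := fun r => Δ.fn s p₀ * Δ.fn s r)
      ((continuous_const.mul (fn_continuous s)).continuousOn)
      (show (0 : ℝ) ∈ Icc _ _ from ⟨not_lt.1 hcon, mul_self_nonneg _⟩)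
    have hr1 := connectedComponentIn_subset _ _ hr
    have hr2 : Δ.fn s r = 0 := (mul_eq_zero.1 hr0).resolve_left (h.2 s hs)
    exact hr1.2 ⟨s, hs, (mem_iff (Or.inl hs)).2 ⟨hr1.1, hr2⟩⟩
  · refine openCell_convex.isPreconnected.subset_connectedComponentIn (mem_openCell h) ?_
    intro q hq
    refine ⟨cell_subset_tri h (openCell_subset_cell hq), ?_⟩
    rintro ⟨s, hs, hqs⟩
    exact (hq s hs).right (fn_eq_zero (Or.inl hs) hqs)

theorem cell_isMinRegion (h : Δ.Generic p₀) : Δ.IsMinRegion (Δ.cell p₀) := by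
  refine ⟨p₀, ⟨h.1, ?_⟩, ?_⟩
  · rintro ⟨s, hs, hps⟩
    exact h.2 s hs (fn_eq_zero (Or.inl hs) hps)
  · rw [component_eq h]
    exact Subset.antisymm (cell_subset_closure h)
      (closure_minimal openCell_subset_cell cell_closed)

open Filter Topology in
theorem mem_frontier (h : Δ.Generic p₀) (hs : s ∈ Δ.Sbar) (hq : q ∈ Δ.cell p₀)
    (h0 : Δ.fn s q = 0) : q ∈ frontier (Δ.cell p₀) := by
  rw [cell_closed.frontier_eq]
  refine ⟨hq, fun hqi => ?_⟩
  have hc : Continuous fun t : ℝ => q + t • (p₀ - q) := by fun_prop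
  have h1 : ∀ᶠ t in 𝓝 (0 : ℝ), q + t • (p₀ - q) ∈ interior (Δ.cell p₀) :=
    hc.continuousAt.eventually_mem (isOpen_interior.mem_nhds (by simpa using hqi))
  obtain ⟨t, ht, ht0⟩ := ((h1.filter_mono nhdsWithin_le_nhds).and
    (self_mem_nhdsWithin : Iio (0 : ℝ) ∈ 𝓝[<] 0)).exists
  have h2 := interior_subset ht s hs
  rw [fn_ray, h0] at h2
  have := mul_neg_of_neg_of_pos (show t < 0 from ht0) (mul_self_pos.2 (h.2 s hs))
  linarith

theorem cell_not_opp (h : Δ.Generic p₀) (hs : s ∈ Δ.Sbar) (hx : x ∈ Δ.cell p₀)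
    (hy : y ∈ Δ.cell p₀) : ¬ Δ.Opp s x y := by
  intro ho
  have h0 := mul_self_pos.2 (h.2 s hs)
  have := mul_nonneg (hx s hs) (hy s hs)
  have h2 := mul_neg_of_pos_of_neg h0 ho
  nlinarith

theorem cell_sm (hs : s ∈ Δ.Sbar) (h : Δ.Generic p₀) (hx : x ∈ Δ.cell p₀)
    (h0 : Δ.fn s x ≠ 0) : Δ.Sm s p₀ x :=
  lt_of_le_of_ne (hx s hs) (mul_ne_zero (h.2 s hs) h0).symm

open Filter Topology in
/-- From a vertex `v` of a minimal region, every initial segment through `v` carries another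
vertex of the region. -/
theorem exists_next (h : Δ.Generic p₀) (hv : v ∈ Δ.cell p₀) (hs : s ∈ Δ.Sbar)
    (hs' : s' ∈ Δ.Sbar) (hne : s ≠ s') (hvs : v ∈ s) (hvs' : v ∈ s') :
    ∃ u, u ≠ v ∧ u ∈ s ∧ u ∈ Δ.cell p₀ ∧ ∃ s'' ∈ Δ.Sbar, s'' ≠ s ∧ u ∈ s'' := by
  have hother : ∀ σ ∈ Δ.Sbar, σ ≠ s → σ ≠ s' → 0 < Δ.fn σ p₀ * Δ.fn σ v := fun σ hσ h1 h2 =>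
    cell_sm hσ h hv (fn_ne (Or.inl hσ) (mem_tri (Or.inl hs) hvs)
      fun h3 => conc hs hs' hσ hne h1.symm h2.symm hvs hvs' h3)
  have hv0 := fn_eq_zero (Or.inl hs) hvs
  have hv0' := fn_eq_zero (Or.inl hs') hvs'
  have hcomp : IsCompact (Δ.cell p₀ ∩ {q | Δ.fn s q = 0}) := by
    have hT : IsCompact Δ.tri := (Set.toFinite _).isCompact_convexHull (𝕜 := ℝ)
    exact hT.of_isClosed_subset
      (cell_closed.inter (isClosed_eq (fn_continuous s) continuous_const))
      (inter_subset_left.trans (cell_subset_tri h))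
  obtain ⟨u, ⟨huK, hu0⟩, hmax⟩ := hcomp.exists_isMaxOn (f := fun q => Δ.fn s' p₀ * Δ.fn s' q)
    ⟨v, hv, hv0⟩ (continuous_const.mul (fn_continuous s')).continuousOn
  have hu0 : Δ.fn s u = 0 := hu0
  obtain ⟨r, hr, hr'⟩ : ∃ r, Δ.fn s r = 0 ∧ 0 < Δ.fn s' p₀ * Δ.fn s' r := by
    obtain ⟨p, hp, hpv⟩ := exists_ne_mem (Or.inl hs : s ∈ Δ.Sbar ∪ Δ.B) v
    have hp0 := not_mem_of_meet (Or.inl hs) (Or.inl hs') hne hvs hvs' hp hpv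
    rcases opp_or_sm (h.2 s' hs') hp0 with h1 | h1
    · refine ⟨v + (-1 : ℝ) • (p - v), ?_, ?_⟩
      · rw [fn_ray, hv0, fn_eq_zero (Or.inl hs) hp]; ring
      · rw [fn_ray, hv0']; rw [Opp] at h1; linarith
    · exact ⟨p, fn_eq_zero (Or.inl hs) hp, h1⟩
  have hpos : 0 < Δ.fn s' p₀ * Δ.fn s' u := by
    have h2 := (Filter.eventually_all_finite (finSbar (Δ := Δ))).2
      (fun σ hσ => show ∀ᶠ t in 𝓝[>] (0 : ℝ), σ ≠ s → σ ≠ s' →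
          0 < Δ.fn σ p₀ * Δ.fn σ (v + t • (r - v)) by
        by_cases h1 : σ = s
        · exact Eventually.of_forall fun _ h => absurd h1 h
        by_cases h2 : σ = s'
        · exact Eventually.of_forall fun _ _ h => absurd h2 h
        exact (eventually_pos (hother σ hσ h1 h2) r).mono fun _ h _ _ => h)
    obtain ⟨t, ht, ht0⟩ := (h2.and self_mem_nhdsWithin).exists
    have ht0 : 0 < t := ht0
    have hval : 0 < Δ.fn s' p₀ * Δ.fn s' (v + t • (r - v)) := by
      rw [fn_ray, hv0']
      have := mul_pos ht0 hr'
      linarith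
    have hz : Δ.fn s (v + t • (r - v)) = 0 := by rw [fn_ray, hv0, hr]; ring
    refine hval.trans_le (hmax ⟨fun σ hσ => ?_, hz⟩)
    by_cases h1 : σ = s
    · rw [h1, hz, mul_zero]
    by_cases h2 : σ = s'
    · rw [h2]; exact hval.le
    exact (ht σ hσ h1 h2).le
  have huv : u ≠ v := by rintro rfl; rw [hv0', mul_zero] at hpos; exact lt_irrefl _ hpos
  have huT := cell_subset_tri h huK
  refine ⟨u, huv, (mem_iff (Or.inl hs)).2 ⟨huT, hu0⟩, huK, ?_⟩
  by_contra! hcon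
  have h2 := (Filter.eventually_all_finite (finSbar (Δ := Δ))).2
    (fun σ hσ => show ∀ᶠ t in 𝓝[>] (0 : ℝ), σ ≠ s →
        0 < Δ.fn σ p₀ * Δ.fn σ (u + t • ((u + (-1 : ℝ) • (v - u)) - u)) by
      by_cases h1 : σ = s
      · exact Eventually.of_forall fun _ h => absurd h1 h
      exact (eventually_pos (cell_sm hσ h huK (fn_ne (Or.inl hσ) huT (hcon σ hσ h1))) _).mono
        fun _ h _ => h)
  obtain ⟨t, ht, ht0⟩ := (h2.and self_mem_nhdsWithin).exists
  have ht0 : 0 < t := ht0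
  have hz : Δ.fn s (u + t • ((u + (-1 : ℝ) • (v - u)) - u)) = 0 := by
    rw [fn_ray, fn_ray, hv0, hu0]; ring
  have h3 := hmax (a := u + t • ((u + (-1 : ℝ) • (v - u)) - u)) ⟨fun σ hσ => by
    by_cases h1 : σ = s
    · rw [h1, hz, mul_zero]
    · exact (ht σ hσ h1).le, hz⟩
  simp only [mem_ofPred_eq, fn_ray, hv0'] at h3
  have := mul_pos ht0 hpos
  linarith

theorem isRegionVertex (h : Δ.Generic p₀) (hv : v ∈ Δ.cell p₀) (hs : s ∈ Δ.Sbar)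
    (hs' : s' ∈ Δ.Sbar) (hne : s ≠ s') (hvs : v ∈ s) (hvs' : v ∈ s') :
    Δ.IsRegionVertex (Δ.cell p₀) v := by
  have key : ∀ {s s' : Set Pt}, s ∈ Δ.Sbar → s' ∈ Δ.Sbar → s ≠ s' → v ∈ s → v ∈ s' →
      Δ.ContainsEdgeOf s (Δ.cell p₀) := by
    intro s s' hs hs' hne hvs hvs'
    obtain ⟨u, huv, hus, huK, -⟩ := exists_next h hv hs hs' hne hvs hvs'
    refine ⟨v, u, huv.symm, fun q hq => ?_⟩
    have hqK := cell_convex.segment_subset hv huK hq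
    have hq0 : Δ.fn s q = 0 := by
      obtain ⟨a, b, ha, hb, hab, rfl⟩ := hq
      rw [fn_comb s _ _ hab, fn_eq_zero (Or.inl hs) hvs, fn_eq_zero (Or.inl hs) hus]; ring
    exact ⟨(mem_iff (Or.inl hs)).2 ⟨cell_subset_tri h hqK, hq0⟩, mem_frontier h hs hqK hq0⟩
  exact ⟨hv, s, hs, s', hs', hne, hvs, hvs', key hs hs' hne hvs hvs',
    key hs' hs hne.symm hvs' hvs⟩

theorem consec (h : Δ.Generic p₀) (hu : u ∈ Δ.cell p₀) (hv : v ∈ Δ.cell p₀) (huv : u ≠ v)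
    (hs : s ∈ Δ.Sbar) (hus : u ∈ s) (hvs : v ∈ s) (hs₂ : s₂ ∈ Δ.Sbar) (h₂ : s ≠ s₂)
    (hus₂ : u ∈ s₂) (hs₄ : s₄ ∈ Δ.Sbar) (h₄ : s ≠ s₄) (hvs₄ : v ∈ s₄) :
    Δ.Consec (Δ.cell p₀) u v := by
  refine ⟨huv, isRegionVertex h hu hs hs₂ h₂ hus hus₂, isRegionVertex h hv hs hs₄ h₄ hvs hvs₄,
    fun q hq => ?_⟩
  have hqK := cell_convex.segment_subset hu hv hq
  refine mem_frontier h hs hqK ?_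
  obtain ⟨a, b, ha, hb, hab, rfl⟩ := hq
  rw [fn_comb s _ _ hab, fn_eq_zero (Or.inl hs) hvs, fn_eq_zero (Or.inl hs) hus]; ring

open Filter Topology in
/-- Just after the vertex `v`, in the direction of `q`, the blocking segment `b` runs inside a
minimal region having `v` as a vertex. -/
theorem exists_face (hb : b ∈ Δ.B) (hs : s ∈ Δ.Sbar) (hs' : s' ∈ Δ.Sbar) (hne : s ≠ s')
    (hv : v ∈ b) (hvs : v ∈ s) (hvs' : v ∈ s') (hq : q ∈ b) (hqv : q ≠ v) :
    ∃ p₀ ∈ b, Δ.Generic p₀ ∧ v ∈ Δ.cell p₀ ∧ Δ.Sm s p₀ q ∧ Δ.Sm s' p₀ q ∧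
      ∀ σ ∈ Δ.Sbar, σ ≠ s → σ ≠ s' → Δ.Sm σ p₀ v := by
  have hvT := mem_tri (Or.inr hb) hv
  have hnz : ∀ σ ∈ Δ.Sbar, σ ≠ s → σ ≠ s' → Δ.fn σ v ≠ 0 := fun σ hσ h1 h2 =>
    fn_ne (Or.inl hσ) hvT fun h3 => conc hs hs' hσ hne h1.symm h2.symm hvs hvs' h3
  have h2 := (Filter.eventually_all_finite (finSbar (Δ := Δ))).2
    (fun σ hσ => show ∀ᶠ t in 𝓝[>] (0 : ℝ), σ ≠ s → σ ≠ s' →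
        0 < Δ.fn σ v * Δ.fn σ (v + t • (q - v)) by
      by_cases h1 : σ = s
      · exact Eventually.of_forall fun _ h => absurd h1 h
      by_cases h2 : σ = s'
      · exact Eventually.of_forall fun _ _ h => absurd h2 h
      exact (eventually_pos (mul_self_pos.2 (hnz σ hσ h1 h2)) q).mono fun _ h _ _ => h)
  have h3 : ∀ᶠ t in 𝓝[>] (0 : ℝ), t < 1 :=
    (gt_mem_nhds (show (0 : ℝ) < 1 by norm_num)).filter_mono nhdsWithin_le_nhds
  obtain ⟨t, ⟨ht, ht1⟩, ht0⟩ := ((h2.and h3).and self_mem_nhdsWithin).exists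
  have ht0 : 0 < t := ht0
  have hsm : ∀ {σ : Set Pt}, σ ∈ Δ.Sbar → v ∈ σ → Δ.Sm σ (v + t • (q - v)) q := by
    intro σ hσ hvσ
    have hq0 := not_mem_of_meet (Or.inr hb) (Or.inl hσ) (B_ne hb hσ) hv hvσ hq hqv
    rw [Sm, fn_ray, fn_eq_zero (Or.inl hσ) hvσ]
    have := mul_pos ht0 (mul_self_pos.2 hq0)
    linarith
  have hot : ∀ σ ∈ Δ.Sbar, σ ≠ s → σ ≠ s' → Δ.Sm σ (v + t • (q - v)) v :=
    fun σ hσ h1 h2 => Sm.symm (ht σ hσ h1 h2)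
  have hpb : v + t • (q - v) ∈ b := mid_mem (Or.inr hb) (x := v) (y := q)
    ⟨1 - t, t, by linarith, ht0, by ring, by ext <;> simp <;> ring⟩ hv hq
  refine ⟨_, hpb, ⟨mem_tri (Or.inr hb) hpb, fun σ hσ => ?_⟩, fun σ hσ => ?_, hsm hs hvs,
    hsm hs' hvs', hot⟩
  · by_cases h1 : σ = s
    · rw [h1]; exact (hsm hs hvs).left
    by_cases h2 : σ = s'
    · rw [h2]; exact (hsm hs' hvs').left
    exact (hot σ hσ h1 h2).left
  · by_cases h1 : σ = s
    · rw [h1, fn_eq_zero (Or.inl hs) hvs, mul_zero]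
    by_cases h2 : σ = s'
    · rw [h2, fn_eq_zero (Or.inl hs') hvs', mul_zero]
    exact (hot σ hσ h1 h2).le

theorem fn_span {a c : Pt} (ha : Δ.fn m a = 0) (hc : Δ.fn m c = 0)
    (hq : q ∈ affineSpan ℝ ({a, c} : Set Pt)) : Δ.fn m q = 0 := by
  obtain ⟨t, rfl⟩ := mem_affineSpan_pair_iff_exists_lineMap_eq.1 hq
  have : AffineMap.lineMap a c t = a + t • (c - a) := by
    rw [AffineMap.lineMap_apply, vsub_eq_sub, vadd_eq_add, add_comm]
  rw [this, fn_ray, ha, hc]; ring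

theorem mem_span (hm : m ∈ Δ.Sbar ∪ Δ.B) (hxy : x ≠ y) (hx : x ∈ m) (hy : y ∈ m) (hq : q ∈ m) :
    q ∈ affineSpan ℝ ({x, y} : Set Pt) := by
  obtain ⟨t, rfl⟩ := exists_ray hm hxy hx hy hq
  refine mem_affineSpan_pair_iff_exists_lineMap_eq.2 ⟨t, ?_⟩
  rw [AffineMap.lineMap_apply, vsub_eq_sub, vadd_eq_add, add_comm]

/-- Condition (A) at a vertex `v₃` of a minimal region with neighbours `v₂`, `v₄`, also in the
degenerate case of a region with few vertices. -/
theorem Strong.concurrent (hstrong : Δ.Strong) (hb : b ∈ Δ.B) (hp₀b : p₀ ∈ b)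
    (h : Δ.Generic p₀)
    (hs : s ∈ Δ.Sbar) (hs' : s' ∈ Δ.Sbar) (hs₂ : s₂ ∈ Δ.Sbar) (hs₄ : s₄ ∈ Δ.Sbar)
    (hne : s ≠ s') (hne₂ : s₂ ≠ s) (hne₄ : s₄ ≠ s')
    (h3b : v₃ ∈ b) (h3s : v₃ ∈ s) (h3s' : v₃ ∈ s') (h2s : v₂ ∈ s) (h2s₂ : v₂ ∈ s₂)
    (h4s' : v₄ ∈ s') (h4s₄ : v₄ ∈ s₄) (hv₃ : v₃ ∈ Δ.cell p₀) (hv₂ : v₂ ∈ Δ.cell p₀)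
    (hv₄ : v₄ ∈ Δ.cell p₀) (h23 : v₂ ≠ v₃) (h43 : v₄ ≠ v₃) (hqb : q ∈ b) (hq₄ : q ∈ s₄) :
    ∃ q' ∈ b, q' ∈ s₂ ∧ q' ∈ s₄ := by
  have e2s' : s₂ ≠ s' := by
    rintro rfl
    exact h23 (meet_eq (Or.inl hs) (Or.inl hs₂) hne h2s h2s₂ h3s h3s')
  have e4s : s₄ ≠ s := by
    rintro rfl
    exact h43 (meet_eq (Or.inl hs₄) (Or.inl hs') hne h4s₄ h4s' h3s h3s')
  by_cases e24 : s₂ = s₄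
  · exact ⟨q, hqb, e24 ▸ hq₄, hq₄⟩
  have n3s₂ : v₃ ∉ s₂ := fun h => conc hs hs' hs₂ hne hne₂.symm e2s'.symm h3s h3s' h
  have n3s₄ : v₃ ∉ s₄ := fun h => conc hs hs' hs₄ hne e4s.symm hne₄.symm h3s h3s' h
  have n2s₄ : v₂ ∉ s₄ := fun h => conc hs hs₂ hs₄ hne₂.symm e4s.symm e24 h2s h2s₂ h
  have n4s₂ : v₄ ∉ s₂ := fun h => conc hs' hs₄ hs₂ hne₄.symm e2s'.symm (Ne.symm e24) h4s' h4s₄ h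
  obtain ⟨v₁, h12, h1s₂, hv₁, t₁, ht₁, ht₁ne, h1t⟩ := exists_next h hv₂ hs₂ hs hne₂ h2s₂ h2s
  obtain ⟨v₅, h54, h5s₄, hv₅, t₅, ht₅, ht₅ne, h5t⟩ := exists_next h hv₄ hs₄ hs' hne₄ h4s₄ h4s'
  have hB : b ∈ Δ.Sbar ∪ Δ.B := Or.inr hb
  by_cases e15 : v₁ = v₅
  · subst e15
    by_cases hy : Δ.fn b v₁ = 0
    · exact ⟨v₁, (mem_iff hB).2 ⟨cell_subset_tri h hv₁, hy⟩, h1s₂, h5s₄⟩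
    exfalso
    have hopp : Δ.Opp b v₂ v₄ := by
      obtain ⟨A, B, hlin⟩ := lin (Or.inl hs) (Or.inl hs') hne h3s h3s' (fn_eq_zero hB h3b)
      have n2b : Δ.fn b v₂ ≠ 0 :=
        not_mem_of_meet (Or.inl hs) hB (B_ne hb hs).symm h3s h3b h2s h23
      have h1 := hlin p₀
      have h2 := hlin v₂
      have h3 := hlin v₄
      rw [fn_eq_zero hB hp₀b] at h1
      rw [fn_eq_zero (Or.inl hs) h2s, mul_zero, zero_add] at h2
      rw [fn_eq_zero (Or.inl hs') h4s', mul_zero, add_zero] at h3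
      have hB0 : B ≠ 0 := by rintro rfl; exact n2b (by rw [h2]; ring)
      have h2p : 0 < Δ.fn s' p₀ * Δ.fn s' v₂ := cell_sm hs' h hv₂ (by
        intro h0; rw [h0, mul_zero] at h2; exact n2b h2)
      have h4p : 0 < Δ.fn s p₀ * Δ.fn s v₄ := cell_sm hs h hv₄
        (not_mem_of_meet (Or.inl hs') (Or.inl hs) hne.symm h3s' h3s h4s' h43)
      have hBb : 0 < (B * Δ.fn s' p₀) ^ 2 :=
        (sq_pos_iff).2 (mul_ne_zero hB0 (h.2 s' hs'))
      rw [Opp, h2, h3]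
      by_contra! hcon
      have e1 : (B * Δ.fn s' v₂ * (A * Δ.fn s v₄)) * ((Δ.fn s p₀ * Δ.fn s' p₀) ^ 2) =
          -(((B * Δ.fn s' p₀) ^ 2) *
            (Δ.fn s' p₀ * Δ.fn s' v₂ * (Δ.fn s p₀ * Δ.fn s v₄))) := by
        have hA : A * Δ.fn s p₀ = -(B * Δ.fn s' p₀) := by linarith
        linear_combination (B * Δ.fn s' v₂ * Δ.fn s v₄ * Δ.fn s p₀ * Δ.fn s' p₀ ^ 2) * hA
      have := mul_pos hBb (mul_pos h2p h4p)
      have := mul_nonneg hcon (sq_nonneg (Δ.fn s p₀ * Δ.fn s' p₀))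
      linarith
    have key : ∀ {w : Pt} {σ : Set Pt}, σ ∈ Δ.Sbar → w ∈ σ → v₁ ∈ σ → w ∈ Δ.cell p₀ →
        ¬ Δ.Opp b w v₁ := by
      intro w σ hσ hwσ h1σ hw ho
      obtain ⟨r, hr, hrb⟩ :=
        exists_cross hB ho (mem_tri (Or.inl hσ) hwσ) (mem_tri (Or.inl hσ) h1σ)
      have hrσ := mid_mem (Or.inl hσ) hr hwσ h1σ
      obtain ⟨k, hk, hkσ, hrk⟩ := second hσ hb hrσ hrb
      refine cell_not_opp h hk hw hv₁ (mid_opp hr (fn_eq_zero (Or.inl hk) hrk) ?_)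
      refine not_mem_of_meet (Or.inl hσ) (Or.inl hk) hkσ.symm hrσ hrk hwσ ?_
      rintro rfl
      exact ho.left (fn_eq_zero hB hrb)
    rcases hopp.split hy with h1 | h1
    · exact key hs₂ h2s₂ h1s₂ hv₂ h1
    · exact key hs₄ h4s₄ h5s₄ hv₄ h1.symm
  · have hdist : List.Pairwise (· ≠ ·) [v₅, v₄, v₃, v₂, v₁] := by
      simp only [List.pairwise_cons, List.mem_cons, List.not_mem_nil, or_false, forall_eq_or_imp,
        forall_eq, IsEmpty.forall_iff, implies_true, List.Pairwise.nil, and_true]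
      refine ⟨⟨h54, ?_, ?_, Ne.symm e15⟩, ⟨h43, ?_, ?_⟩, ⟨h23.symm, ?_⟩, h12.symm⟩
      · rintro rfl; exact n3s₄ h5s₄
      · rintro rfl; exact n2s₄ h5s₄
      · rintro rfl; exact n2s₄ h4s₄
      · rintro rfl; exact n4s₂ h1s₂
      · rintro rfl; exact n3s₂ h1s₂
    obtain ⟨q', hq'b, hq'1, hq'2⟩ := hstrong _ (cell_isMinRegion h) v₅ v₄ v₃ v₂ v₁ hdist
      (consec h hv₅ hv₄ h54 hs₄ h5s₄ h4s₄ ht₅ ht₅ne.symm h5t hs' hne₄ h4s')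
      (consec h hv₄ hv₃ h43 hs' h4s' h3s' hs₄ hne₄.symm h4s₄ hs hne.symm h3s)
      (consec h hv₃ hv₂ h23.symm hs h3s h2s hs' hne h3s' hs₂ hne₂.symm h2s₂)
      (consec h hv₂ hv₁ h12.symm hs₂ h2s₂ h1s₂ hs hne₂ h2s ht₁ ht₁ne.symm h1t)
      b hb h3b ⟨p₀, hp₀b, mem_interior_cell h⟩
      ⟨q, mem_tri hB hqb, mem_span (Or.inl hs₄) h54 h5s₄ h4s₄ hq₄, hqb⟩
    have hq'T := mem_tri hB hq'b
    exact ⟨q', hq'b, (mem_iff (Or.inl hs₂)).2 ⟨hq'T, fn_span (fn_eq_zero (Or.inl hs₂) h2s₂)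
      (fn_eq_zero (Or.inl hs₂) h1s₂) hq'2⟩, (mem_iff (Or.inl hs₄)).2 ⟨hq'T,
      fn_span (fn_eq_zero (Or.inl hs₄) h5s₄) (fn_eq_zero (Or.inl hs₄) h4s₄) hq'1⟩⟩

end TBA

namespace TBA

/-! ### Triangles formed by three initial segments, and counting -/

/-- Three initial segments forming a triangle with vertices `c`, `u`, `v`. -/
structure Tri (Δ : TBA) (a b l : Set Pt) (c u v : Pt) : Prop where
  ha : a ∈ Δ.Sbar
  hb : b ∈ Δ.Sbar
  hl : l ∈ Δ.Sbar
  hab : a ≠ b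
  hal : a ≠ l
  hbl : b ≠ l
  hca : c ∈ a
  hcb : c ∈ b
  hua : u ∈ a
  hul : u ∈ l
  hvb : v ∈ b
  hvl : v ∈ l

/-- The blocking segment through `c` separates `p` and `q`. -/
def In (Δ : TBA) (c p q : Pt) : Prop := ∃ b ∈ Δ.B, c ∈ b ∧ Δ.Opp b p q

variable {Δ : TBA} {a b l s s' k σ : Set Pt} {c u v x y z p q w : Pt}

theorem In.symm (h : Δ.In c p q) : Δ.In c q p :=
  let ⟨b, hb, hc, ho⟩ := h; ⟨b, hb, hc, ho.symm⟩

namespace Tri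

theorem swap (h : Δ.Tri a b l c u v) : Δ.Tri b a l c v u :=
  ⟨h.hb, h.ha, h.hl, h.hab.symm, h.hbl, h.hal, h.hcb, h.hca, h.hvb, h.hvl, h.hua, h.hul⟩

theorem rot (h : Δ.Tri a b l c u v) : Δ.Tri l a b u v c :=
  ⟨h.hl, h.ha, h.hb, h.hal.symm, h.hbl.symm, h.hab, h.hul, h.hua, h.hvl, h.hvb, h.hca, h.hcb⟩

theorem fc (h : Δ.Tri a b l c u v) : Δ.fn l c ≠ 0 := fun h0 =>
  conc h.ha h.hb h.hl h.hab h.hal h.hbl h.hca h.hcb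
    ((mem_iff (Or.inl h.hl)).2 ⟨mem_tri (Or.inl h.ha) h.hca, h0⟩)

theorem fu (h : Δ.Tri a b l c u v) : Δ.fn b u ≠ 0 := h.rot.fc

theorem fv (h : Δ.Tri a b l c u v) : Δ.fn a v ≠ 0 := h.rot.rot.fc

theorem tc (h : Δ.Tri a b l c u v) : c ∈ Δ.tri := mem_tri (Or.inl h.ha) h.hca
theorem tu (h : Δ.Tri a b l c u v) : u ∈ Δ.tri := mem_tri (Or.inl h.ha) h.hua
theorem tv (h : Δ.Tri a b l c u v) : v ∈ Δ.tri := mem_tri (Or.inl h.hb) h.hvb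

theorem cu (h : Δ.Tri a b l c u v) : c ≠ u := fun e => h.fu (e ▸ fn_eq_zero (Or.inl h.hb) h.hcb)
theorem cv (h : Δ.Tri a b l c u v) : c ≠ v := h.swap.cu
theorem uv (h : Δ.Tri a b l c u v) : u ≠ v := h.rot.cu

/-- A segment through `c` separating `u` and `v` is not an initial segment. -/
theorem not_zero (h : Δ.Tri a b l c u v) (hs : s ∈ Δ.Sbar) (ho : Δ.Opp s u v) :
    Δ.fn s c ≠ 0 := fun h0 => by
  refine conc h.ha h.hb hs h.hab ?_ ?_ h.hca h.hcb ((mem_iff (Or.inl hs)).2 ⟨h.tc, h0⟩)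
  · rintro rfl; exact ho.left (fn_eq_zero (Or.inl hs) h.hua)
  · rintro rfl; exact ho.right (fn_eq_zero (Or.inl hs) h.hvb)

end Tri

theorem opp_of_mid (hσ : σ ∈ Δ.Sbar ∪ Δ.B) (hs : s ∈ Δ.Sbar ∪ Δ.B) (hne : σ ≠ s) (hxy : x ≠ y)
    (hx : x ∈ σ) (hy : y ∈ σ) (hq : q ∈ openSegment ℝ x y) (hqs : q ∈ s) : Δ.Opp s x y :=
  mid_opp hq (fn_eq_zero hs hqs) (not_mem_of_meet hσ hs hne (mid_mem hσ hq hx hy) hqs hx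
    fun h => hxy ((left_mem_openSegment_iff (𝕜 := ℝ)).1 (by rwa [← h] at hq)))

theorem Opp.ne_of_mem (h : Δ.Opp s x y) (hs : s ∈ Δ.Sbar ∪ Δ.B) (hx : x ∈ σ) : σ ≠ s := by
  rintro rfl; exact h.left (fn_eq_zero hs hx)

/-- An initial segment separating two points of an initial segment crosses it at a vertex, whose
blocking segment separates the two points as well. -/
theorem cross_S (hσ : σ ∈ Δ.Sbar) (hx : x ∈ σ) (hy : y ∈ σ) (hs : s ∈ Δ.Sbar)
    (h : Δ.Opp s x y) : ∃ q ∈ openSegment ℝ x y, q ∈ σ ∧ q ∈ s ∧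
      ∃ b ∈ Δ.B, q ∈ b ∧ Δ.Opp b x y := by
  have hxT := mem_tri (Or.inl hσ) hx
  have hyT := mem_tri (Or.inl hσ) hy
  obtain ⟨q, hq, hqs⟩ := exists_cross (Or.inl hs) h hxT hyT
  have hqσ := mid_mem (Or.inl hσ) hq hx hy
  have hne := h.ne_of_mem (Or.inl hs) hx
  obtain ⟨b, hb, hqb⟩ := exists_block (opp_mem_S hs hxT hyT h) hσ hne.symm hqs hqσ
  exact ⟨q, hq, hqσ, hqs, b, hb, hqb,
    opp_of_mid (Or.inl hσ) (Or.inr hb) (B_ne hb hσ).symm h.ne hx hy hq hqb⟩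

theorem cross_B (hσ : σ ∈ Δ.Sbar) (hx : x ∈ σ) (hy : y ∈ σ) (hb : b ∈ Δ.B)
    (h : Δ.Opp b x y) : ∃ q ∈ openSegment ℝ x y, q ∈ σ ∧ q ∈ b ∧
      ∃ s ∈ Δ.Sbar, s ≠ σ ∧ q ∈ s ∧ Δ.Opp s x y := by
  obtain ⟨q, hq, hqb⟩ := exists_cross (Or.inr hb) h (mem_tri (Or.inl hσ) hx)
    (mem_tri (Or.inl hσ) hy)
  have hqσ := mid_mem (Or.inl hσ) hq hx hy
  obtain ⟨s, hs, hne, hqs⟩ := second hσ hb hqσ hqb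
  exact ⟨q, hq, hqσ, hqb, s, hs, hne, hqs,
    opp_of_mid (Or.inl hσ) (Or.inl hs) hne.symm h.ne hx hy hq hqs⟩

/-- As many initial as blocking segments separate two points of an initial segment. -/
theorem card_eq (hσ : σ ∈ Δ.Sbar) (hx : x ∈ σ) (hy : y ∈ σ) :
    {s ∈ Δ.Sbar | Δ.Opp s x y}.ncard = {b ∈ Δ.B | Δ.Opp b x y}.ncard := by
  choose! f hf1 hf2 hf3 g hg1 hg2 hg3 using
    fun s (hs : s ∈ Δ.Sbar ∧ Δ.Opp s x y) => cross_S hσ hx hy hs.1 hs.2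
  refine Set.ncard_congr (fun s _ => g s) (fun s hs => ⟨hg1 s hs, hg3 s hs⟩)
    (fun s t hs ht h => ?_) (fun b hb => ?_)
  · have hne : ∀ s, s ∈ Δ.Sbar ∧ Δ.Opp s x y → σ ≠ s :=
      fun s hs => hs.2.ne_of_mem (Or.inl hs.1) hx
    have h1 : f s = f t := meet_eq (Or.inl hσ) (Or.inr (hg1 s hs)) (B_ne (hg1 s hs) hσ).symm
      (hf2 s hs) (hg2 s hs) (hf2 t ht) (h ▸ hg2 t ht)
    by_contra hst
    exact conc hσ hs.1 ht.1 (hne s hs) (hne t ht) hst (hf2 s hs) (hf3 s hs) (h1 ▸ hf3 t ht)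
  · obtain ⟨q, hq, hqσ, hqb, s, hs, hne, hqs, ho⟩ := cross_B hσ hx hy hb.1 hb.2
    have hsm : s ∈ Δ.Sbar ∧ Δ.Opp s x y := ⟨hs, ho⟩
    refine ⟨s, hsm, ?_⟩
    have h1 : f s = q := meet_eq (Or.inl hσ) (Or.inl hs) hne.symm (hf2 s hsm) (hf3 s hsm) hqσ hqs
    exact block_eq hσ hs hne.symm hqσ hqs (hg1 s hsm) hb.1 (h1 ▸ hg2 s hsm) hqb

open Classical in
/-- The indicator of the separation of two points by a segment. -/
def ind (Δ : TBA) (s : Set Pt) (x y : Pt) : ℕ := if Δ.Opp s x y then 1 else 0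

theorem ind_comm : Δ.ind s x y = Δ.ind s y x := by
  have : Δ.Opp s x y ↔ Δ.Opp s y x := ⟨Opp.symm, Opp.symm⟩
  by_cases h : Δ.Opp s x y
  · simp [ind, h, this.1 h]
  · simp [ind, h, mt this.2 h]

theorem sum_eq (hσ : σ ∈ Δ.Sbar) (hx : x ∈ σ) (hy : y ∈ σ) :
    ∑ s ∈ (finSbar (Δ := Δ)).toFinset, Δ.ind s x y = ∑ b ∈ Δ.finB.toFinset, Δ.ind b x y := by
  classical
  have h := card_eq hσ hx hy
  simp only [ind, Finset.sum_boole, Nat.cast_id]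
  rw [← Set.ncard_coe_finset, ← Set.ncard_coe_finset]
  simpa using h

theorem ind_of_ne_zero (hx : Δ.fn s x ≠ 0) (hy : Δ.fn s y ≠ 0) (hz : Δ.fn s z ≠ 0) :
    Δ.ind s y z = Δ.ind s x y + Δ.ind s x z ∨ (Δ.Opp s x y ∧ Δ.Opp s x z ∧ ¬ Δ.Opp s y z) := by
  simp only [ind]
  by_cases h1 : Δ.Opp s x y <;> by_cases h2 : Δ.Opp s x z
  · exact Or.inr ⟨h1, h2, (h1.symm.trans h2).not_opp⟩
  · have := h1.symm.sm (sm_of_not_opp hx hz h2)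
    simp [*]
  · have := (sm_of_not_opp hx hy h1).symm.opp h2
    simp [*]
  · have := ((sm_of_not_opp hx hy h1).symm.trans (sm_of_not_opp hx hz h2)).not_opp
    simp [*]

theorem ind_of_zero (hx : Δ.fn s x = 0) : Δ.ind s x y = 0 := by
  simp [ind, Opp, hx]

theorem ind_of_zero' (hx : Δ.fn s x = 0) : Δ.ind s y x = 0 := by
  simp [ind, Opp, hx]

open Classical in
/-- The blocking segments separating the corners of a triangle, in terms of the corners. -/
theorem ind_cast (hs : s ∈ Δ.Sbar ∪ Δ.B) (hc : c ∈ Δ.tri) (hu : u ∈ Δ.tri) (hv : v ∈ Δ.tri) :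
    ((Δ.ind s c u + Δ.ind s u v + Δ.ind s v c : ℕ) : ZMod 2) =
      (if c ∈ s ∧ Δ.Opp s u v then 1 else 0) + (if u ∈ s ∧ Δ.Opp s v c then 1 else 0) +
      (if v ∈ s ∧ Δ.Opp s c u then 1 else 0) := by
  have hn : ∀ {x}, x ∈ Δ.tri → (x ∈ s ↔ Δ.fn s x = 0) := fun hx => by simp [mem_iff hs, hx]
  rw [hn hc, hn hu, hn hv]
  by_cases h1 : Δ.fn s c = 0
  · have o1 : ∀ y, ¬ Δ.Opp s c y := fun y => by simp [Opp, h1]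
    have o2 : ∀ y, ¬ Δ.Opp s y c := fun y => by simp [Opp, h1]
    simp [ind, o1, o2, h1]
  by_cases h2 : Δ.fn s u = 0
  · have o1 : ∀ y, ¬ Δ.Opp s u y := fun y => by simp [Opp, h2]
    have o2 : ∀ y, ¬ Δ.Opp s y u := fun y => by simp [Opp, h2]
    simp [ind, o1, o2, h2]
  by_cases h3 : Δ.fn s v = 0
  · have o1 : ∀ y, ¬ Δ.Opp s v y := fun y => by simp [Opp, h3]
    have o2 : ∀ y, ¬ Δ.Opp s y v := fun y => by simp [Opp, h3]
    simp [ind, o1, o2, h3]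
  simp only [h1, h2, h3, false_and, if_false, add_zero]
  rw [ind_comm (x := v) (y := c)]
  rcases ind_of_ne_zero h1 h2 h3 with h | ⟨o1, o2, o3⟩
  · rw [h]
    rw [show Δ.ind s c u + (Δ.ind s c u + Δ.ind s c v) + Δ.ind s c v
      = 2 * (Δ.ind s c u + Δ.ind s c v) by ring]
    push_cast
    exact zero_mul _
  · simp only [ind, o1, o2, o3, if_true, if_false]
    rfl

open Classical in
theorem sum_In (hσ : σ ∈ Δ.Sbar) (hk : k ∈ Δ.Sbar) (hne : σ ≠ k) (hc : c ∈ σ) (hc' : c ∈ k) :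
    ∑ b ∈ Δ.finB.toFinset, (if c ∈ b ∧ Δ.Opp b p q then 1 else 0 : ZMod 2) =
      if Δ.In c p q then 1 else 0 := by
  split_ifs with h
  · obtain ⟨b, hb, hcb, ho⟩ := h
    rw [Finset.sum_eq_single b, if_pos ⟨hcb, ho⟩]
    · intro b' hb' hbb
      rw [if_neg]
      rintro ⟨h1, -⟩
      exact hbb (block_eq hσ hk hne hc hc' (by simpa using hb') hb h1 hcb)
    · simp [hb]
  · refine Finset.sum_eq_zero fun b hb => if_neg fun hh => h ⟨b, by simpa using hb, hh⟩

/-- Parity: an even number of the corners of a triangle are blocked in the triangle. -/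
theorem Tri.parity (h : Δ.Tri a b l c u v) : Δ.In c u v ↔ ¬ (Δ.In u c v ↔ Δ.In v c u) := by
  classical
  have h1 := sum_eq h.ha h.hca h.hua
  have h2 := sum_eq h.hl h.hul h.hvl
  have h3 := sum_eq h.hb h.hvb h.hcb
  have hS : ((∑ s ∈ (finSbar (Δ := Δ)).toFinset,
      (Δ.ind s c u + Δ.ind s u v + Δ.ind s v c) : ℕ) : ZMod 2) = 0 := by
    rw [Nat.cast_sum]
    refine Finset.sum_eq_zero fun s hs => ?_
    have hs : s ∈ Δ.Sbar := by simpa using hs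
    have hz : ∀ {x}, x ∈ s → Δ.fn s x = 0 := fun hx => fn_eq_zero (Or.inl hs) hx
    rw [ind_cast (Or.inl hs) h.tc h.tu h.tv, if_neg, if_neg, if_neg, add_zero, add_zero]
    · exact fun hh => h.rot.rot.not_zero hs hh.2 (hz hh.1)
    · exact fun hh => h.rot.not_zero hs hh.2 (hz hh.1)
    · exact fun hh => h.not_zero hs hh.2 (hz hh.1)
  rw [Finset.sum_add_distrib, Finset.sum_add_distrib, h1, h2, h3, ← Finset.sum_add_distrib,
    ← Finset.sum_add_distrib, Nat.cast_sum, Finset.sum_congr rfl fun b hb =>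
      ind_cast (Or.inr (by simpa using hb)) h.tc h.tu h.tv, Finset.sum_add_distrib,
    Finset.sum_add_distrib, sum_In h.ha h.hb h.hab h.hca h.hcb,
    sum_In h.ha h.hl h.hal h.hua h.hul, sum_In h.hb h.hl h.hbl h.hvb h.hvl] at hS
  have e : Δ.In u v c ↔ Δ.In u c v := ⟨In.symm, In.symm⟩
  rw [e] at hS
  by_cases i1 : Δ.In c u v <;> by_cases i2 : Δ.In u c v <;> by_cases i3 : Δ.In v c u <;>
    simp [i1, i2, i3] at hS ⊢
  exact absurd hS (by decide)

/-- If no initial segment cuts off the unblocked corner `c`, then no corner is blocked. -/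
theorem Tri.not_in (h : Δ.Tri a b l c u v) (hcut : ∀ s ∈ Δ.Sbar, Δ.Opp s c u → ¬ Δ.Opp s c v)
    (hc : ¬ Δ.In c u v) : ¬ Δ.In u c v := by
  rintro ⟨b₀, hb₀, hub₀, ho⟩
  have h1 := sum_eq h.ha h.hca h.hua
  have h2 := sum_eq h.hl h.hul h.hvl
  have h3 := sum_eq h.hb h.hcb h.hvb
  have hS : ∑ s ∈ (finSbar (Δ := Δ)).toFinset, Δ.ind s u v =
      ∑ s ∈ (finSbar (Δ := Δ)).toFinset, (Δ.ind s c u + Δ.ind s c v) := by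
    refine Finset.sum_congr rfl fun s hs => ?_
    have hs : s ∈ Δ.Sbar := by simpa using hs
    have z : ∀ {x y}, ¬ Δ.Opp s x y → Δ.ind s x y = 0 := fun h => by simp [ind, h]
    by_cases hc0 : Δ.fn s c = 0
    · rw [ind_of_zero hc0, ind_of_zero hc0, z fun ho => h.not_zero hs ho hc0]
    by_cases hu0 : Δ.fn s u = 0
    · rw [ind_of_zero hu0, ind_of_zero' hu0, z fun ho => h.rot.not_zero hs ho.symm hu0]
    by_cases hv0 : Δ.fn s v = 0
    · rw [ind_of_zero' hv0, ind_of_zero' hv0, z fun ho => h.rot.rot.not_zero hs ho hv0]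
    exact (ind_of_ne_zero hc0 hu0 hv0).resolve_right fun hh => hcut s hs hh.1 hh.2.1
  have hB : ∑ s ∈ Δ.finB.toFinset, Δ.ind s u v <
      ∑ s ∈ Δ.finB.toFinset, (Δ.ind s c u + Δ.ind s c v) := by
    refine Finset.sum_lt_sum (fun s hs => ?_) ⟨b₀, by simpa using hb₀, ?_⟩
    · have hs : s ∈ Δ.B := by simpa using hs
      by_cases hu0 : Δ.fn s u = 0
      · rw [ind_of_zero hu0]; exact Nat.zero_le _
      by_cases hv0 : Δ.fn s v = 0
      · rw [ind_of_zero' hv0]; exact Nat.zero_le _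
      by_cases hc0 : Δ.fn s c = 0
      · have : ¬ Δ.Opp s u v := fun ho => hc ⟨s, hs, (mem_iff (Or.inr hs)).2 ⟨h.tc, hc0⟩, ho⟩
        simp [ind, this]
      rcases ind_of_ne_zero hc0 hu0 hv0 with h' | h'
      · exact h'.le
      · simp [ind, h']
    · have hu0 := fn_eq_zero (Or.inr hb₀) hub₀
      rw [ind_of_zero hu0, ind_of_zero' hu0, ind, if_pos ho]
      exact Nat.one_pos
  rw [Finset.sum_add_distrib, ← h1, ← h3, ← Finset.sum_add_distrib, ← hS, ← h2] at hB
  exact lt_irrefl _ hB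

end TBA

namespace TBA

/-! ### Triangles with an internally blocked corner -/

variable {Δ : TBA} {a b l g s s' k σ β β₁ b' : Set Pt} {c u v x y y' z p q r w : Pt}

theorem not_opp_zero (h : Δ.fn s x = 0) : ¬ Δ.Opp s x y := fun ho => ho.left h

theorem not_opp_zero' (h : Δ.fn s x = 0) : ¬ Δ.Opp s y x := fun ho => ho.right h

theorem mid_sm_of_ne (hq : q ∈ openSegment ℝ x y) (hy : Δ.fn s y = 0) (h : Δ.fn s q ≠ 0) :
    Δ.Sm s q x := mid_sm_left hq hy fun hx => h (mid_zero hq hx hy)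

theorem Sm.nonneg_of_not_opp (h : Δ.Sm s x y) (ho : ¬ Δ.Opp s y z) :
    0 ≤ Δ.fn s x * Δ.fn s z := by
  by_cases hz : Δ.fn s z = 0
  · simp [hz]
  · exact (h.trans (sm_of_not_opp h.right hz ho)).le

theorem hull_opp (hx : x ∈ convexHull ℝ ({c, u, v} : Set Pt))
    (hy : y ∈ convexHull ℝ ({c, u, v} : Set Pt)) (h : Δ.Opp s x y) :
    Δ.Opp s c u ∨ Δ.Opp s c v ∨ Δ.Opp s u v := by
  obtain ⟨p₁, p₂, p₃, h1, h2, h3, e, rfl⟩ := mem_hull3.1 hx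
  obtain ⟨r₁, r₂, r₃, k1, k2, k3, e', rfl⟩ := mem_hull3.1 hy
  by_contra hcon
  simp only [Opp, not_or, not_lt] at hcon h
  obtain ⟨n1, n2, n3⟩ := hcon
  have key : ∀ {p₁ p₂ p₃ : ℝ}, p₁ + p₂ + p₃ = 1 → Δ.fn s (p₁ • c + p₂ • u + p₃ • v) =
      p₁ * Δ.fn s c + p₂ * Δ.fn s u + p₃ * Δ.fn s v := fun {p₁ p₂ p₃} e => by
    obtain rfl : p₁ = 1 - p₂ - p₃ := by linarith
    simp only [fn, aff, Prod.fst_add, Prod.snd_add, Prod.smul_fst, Prod.smul_snd, smul_eq_mul]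
    ring
  rw [key e, key e'] at h
  have := mul_self_nonneg (Δ.fn s c)
  have := mul_self_nonneg (Δ.fn s u)
  have := mul_self_nonneg (Δ.fn s v)
  have : (p₁ * Δ.fn s c + p₂ * Δ.fn s u + p₃ * Δ.fn s v) *
      (r₁ * Δ.fn s c + r₂ * Δ.fn s u + r₃ * Δ.fn s v) =
      p₁ * r₁ * (Δ.fn s c * Δ.fn s c) + p₂ * r₂ * (Δ.fn s u * Δ.fn s u) +
      p₃ * r₃ * (Δ.fn s v * Δ.fn s v) + (p₁ * r₂ + p₂ * r₁) * (Δ.fn s c * Δ.fn s u) +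
      (p₁ * r₃ + p₃ * r₁) * (Δ.fn s c * Δ.fn s v) +
      (p₂ * r₃ + p₃ * r₂) * (Δ.fn s u * Δ.fn s v) := by ring
  have : 0 ≤ (p₁ * Δ.fn s c + p₂ * Δ.fn s u + p₃ * Δ.fn s v) *
      (r₁ * Δ.fn s c + r₂ * Δ.fn s u + r₃ * Δ.fn s v) := by rw [this]; positivity
  linarith

theorem mid_hull {H : Set Pt} (hq : q ∈ openSegment ℝ x y) (hx : x ∈ convexHull ℝ H)
    (hy : y ∈ convexHull ℝ H) : q ∈ convexHull ℝ H :=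
  (convex_convexHull ℝ H).openSegment_subset hx hy hq

/-- The number of initial segments separating corners of a triangle. -/
def mu (Δ : TBA) (c u v : Pt) : ℕ := {s ∈ Δ.Sbar | Δ.Opp s c u ∨ Δ.Opp s c v ∨ Δ.Opp s u v}.ncard

theorem mu_lt (hx : x ∈ convexHull ℝ ({c, u, v} : Set Pt))
    (hy : y ∈ convexHull ℝ ({c, u, v} : Set Pt)) (hz : z ∈ convexHull ℝ ({c, u, v} : Set Pt))
    (hk : k ∈ Δ.Sbar) (ho : Δ.Opp k c u ∨ Δ.Opp k c v ∨ Δ.Opp k u v)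
    (hxy : ¬ Δ.Opp k x y) (hxz : ¬ Δ.Opp k x z) (hyz : ¬ Δ.Opp k y z) :
    Δ.mu x y z < Δ.mu c u v := by
  refine Set.ncard_lt_ncard ⟨fun s hs => ⟨hs.1, ?_⟩, fun hsub => ?_⟩
    (finSbar.subset fun s hs => hs.1)
  · rcases hs.2 with h | h | h
    · exact hull_opp hx hy h
    · exact hull_opp hx hz h
    · exact hull_opp hy hz h
  · obtain ⟨-, h | h | h⟩ := hsub ⟨hk, ho⟩
    exacts [hxy h, hxz h, hyz h]

/-- A triangle with two proper sides whose corner `c` is internally blocked by `β`, such that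
smaller triangles have no such corner. -/
structure Cfg (Δ : TBA) (a b l β : Set Pt) (c u v : Pt) : Prop where
  T : Δ.Tri a b l c u v
  aS : a ∈ Δ.S
  bS : b ∈ Δ.S
  ih : ∀ {a' b' l' : Set Pt} {c' u' v' : Pt}, Δ.Tri a' b' l' c' u' v' → a' ∈ Δ.S → b' ∈ Δ.S →
    Δ.mu c' u' v' < Δ.mu c u v → ¬ Δ.In c' u' v'
  βB : β ∈ Δ.B
  cβ : c ∈ β
  oβ : Δ.Opp β u v

theorem mu_comm : Δ.mu c u v = Δ.mu c v u := by
  unfold mu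
  congr 1
  ext s
  have : Δ.Opp s u v ↔ Δ.Opp s v u := ⟨Opp.symm, Opp.symm⟩
  change s ∈ Δ.Sbar ∧ _ ↔ s ∈ Δ.Sbar ∧ _
  tauto

namespace Tri

theorem nc (h : Δ.Tri a b l c u v) (hk : k ∈ Δ.Sbar) (ha : a ≠ k) (hb : b ≠ k) :
    Δ.fn k c ≠ 0 := fn_ne (Or.inl hk) h.tc fun hh => conc h.ha h.hb hk h.hab ha hb h.hca h.hcb hh

theorem nu (h : Δ.Tri a b l c u v) (hk : k ∈ Δ.Sbar) (ha : a ≠ k) (hl : l ≠ k) :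
    Δ.fn k u ≠ 0 := h.rot.nc hk hl ha

theorem nv (h : Δ.Tri a b l c u v) (hk : k ∈ Δ.Sbar) (hb : b ≠ k) (hl : l ≠ k) :
    Δ.fn k v ≠ 0 := h.rot.rot.nc hk hb hl

theorem hc (_ : Δ.Tri a b l c u v) : c ∈ convexHull ℝ ({c, u, v} : Set Pt) :=
  subset_convexHull _ _ (by simp)

theorem hu (_ : Δ.Tri a b l c u v) : u ∈ convexHull ℝ ({c, u, v} : Set Pt) :=
  subset_convexHull _ _ (by simp)

theorem hv (_ : Δ.Tri a b l c u v) : v ∈ convexHull ℝ ({c, u, v} : Set Pt) :=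
  subset_convexHull _ _ (by simp)

end Tri

namespace Cfg

theorem swap (C : Δ.Cfg a b l β c u v) : Δ.Cfg b a l β c v u :=
  ⟨C.T.swap, C.bS, C.aS, fun T ha hb hm => C.ih T ha hb (hm.trans_eq mu_comm), C.βB, C.cβ,
    C.oβ.symm⟩

/-- No initial segment cuts off the corner `c`. -/
theorem uncut (C : Δ.Cfg a b l β c u v) (hk : k ∈ Δ.Sbar) (h₁ : Δ.Opp k c u) :
    ¬ Δ.Opp k c v := fun h₂ => by
  have T := C.T
  obtain ⟨p, hp, hpa, hpk, -⟩ := cross_S T.ha T.hca T.hua hk h₁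
  obtain ⟨q, hq, hqb, hqk, -⟩ := cross_S T.hb T.hcb T.hvb hk h₂
  have T' : Δ.Tri a b k c p q := ⟨T.ha, T.hb, hk, T.hab, h₁.ne_of_mem (Or.inl hk) T.hca,
    h₁.ne_of_mem (Or.inl hk) T.hcb, T.hca, T.hcb, hpa, hpk, hqb, hqk⟩
  have zp := fn_eq_zero (Or.inl hk) hpk
  have zq := fn_eq_zero (Or.inl hk) hqk
  have zc := fn_eq_zero (Or.inr C.βB) C.cβ
  refine C.ih T' C.aS C.bS (mu_lt T.hc (mid_hull hp T.hc T.hu) (mid_hull hq T.hc T.hv) hk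
    (Or.inl h₁) (not_opp_zero' zp) (not_opp_zero' zq) (not_opp_zero zp))
    ⟨β, C.βB, C.cβ, ?_⟩
  exact ((mid_sm_right hp zc C.oβ.left).opp C.oβ).sm (mid_sm_right hq zc C.oβ.right).symm

theorem sm_right (C : Δ.Cfg a b l β c u v) (hk : k ∈ Δ.Sbar) (h : Δ.Opp k c u) : Δ.Sm k c v :=
  sm_of_not_opp h.left (C.T.nv hk (h.ne_of_mem (Or.inl hk) C.T.hcb)
    (h.symm.ne_of_mem (Or.inl hk) C.T.hul)) (C.uncut hk h)

/-- A segment separating `c` from `u` meets the side `uv`. -/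
theorem base (C : Δ.Cfg a b l β c u v) (hk : k ∈ Δ.Sbar) (h : Δ.Opp k c u) : Δ.Opp k u v :=
  h.symm.sm (C.sm_right hk h)

end Cfg

/-- A configuration together with the second initial segment `g` through the vertex `w` at which
`β` meets the side `uv`, where `g` meets the side `cv` at `z`, and the blocking segment `β₁`
through `u`. -/
structure Cfg' (Δ : TBA) (a b l g β β₁ : Set Pt) (c u v w z : Pt) : Prop
    extends Δ.Cfg a b l β c u v where
  gS : g ∈ Δ.S
  hgl : g ≠ l
  hbg : b ≠ g
  hag : a ≠ g
  hwm : w ∈ openSegment ℝ u v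
  hwl : w ∈ l
  hwg : w ∈ g
  hwβ : w ∈ β
  hzm : z ∈ openSegment ℝ c v
  hzb : z ∈ b
  hzg : z ∈ g
  hz : ¬ Δ.In z v w
  hv : ¬ Δ.In v c u
  β₁B : β₁ ∈ Δ.B
  hu : u ∈ β₁
  oβ₁ : Δ.Opp β₁ c v

theorem Cfg.exists_cfg' (C : Δ.Cfg a b l β c u v) (hg : g ∈ Δ.Sbar) (hgl : g ≠ l)
    (hwm : w ∈ openSegment ℝ u v) (hwl : w ∈ l) (hwg : w ∈ g) (hwβ : w ∈ β) (oguv : Δ.Opp g u v)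
    (og : Δ.Opp g c v) : ∃ z β₁, Δ.Cfg' a b l g β β₁ c u v w z := by
  have T := C.T
  have gS := opp_mem_S hg T.tu T.tv oguv
  obtain ⟨z, hzm, hzb, hzg, -⟩ := cross_S T.hb T.hcb T.hvb hg og
  have hbg := og.ne_of_mem (Or.inl hg) T.hcb
  have T' : Δ.Tri b g l z v w :=
    ⟨T.hb, hg, T.hl, hbg, T.hbl, hgl, hzb, hzg, T.hvb, T.hvl, hwg, hwl⟩
  have zz := fn_eq_zero (Or.inl hg) hzg
  have zw := fn_eq_zero (Or.inl hg) hwg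
  have hz : ¬ Δ.In z v w := C.ih T' C.bS gS (mu_lt (mid_hull hzm T.hc T.hv) T.hv
    (mid_hull hwm T.hu T.hv) hg (Or.inr (Or.inl og)) (not_opp_zero zz) (not_opp_zero zz)
    (not_opp_zero' zw))
  have zc := fn_eq_zero (Or.inr C.βB) C.cβ
  have hw : ¬ Δ.In w z v := by
    rintro ⟨b', hb', hw', ho⟩
    rw [block_eq hg T.hl hgl hwg hwl hb' C.βB hw' hwβ] at ho
    exact (mid_sm_right hzm zc C.oβ.right).not_opp ho
  have hvzw : ¬ Δ.In v z w := by
    have := T'.parity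
    tauto
  have hv : ¬ Δ.In v c u := by
    rintro ⟨b', hb', hv', ho⟩
    have zv := fn_eq_zero (Or.inr hb') hv'
    exact hvzw ⟨b', hb', hv', ((mid_sm_left hzm zv ho.left).opp ho).sm
      (mid_sm_left hwm zv ho.right).symm⟩
  have hcin : Δ.In c u v := ⟨β, C.βB, C.cβ, C.oβ⟩
  obtain ⟨β₁, h1, h2, h3⟩ : Δ.In u c v := by
    have := T.parity
    tauto
  exact ⟨z, β₁, { C with
    gS, hgl, hbg, hag := og.ne_of_mem (Or.inl hg) T.hca, hwm, hwl, hwg, hwβ, hzm,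
    hzb, hzg, hz, hv, β₁B := h1, hu := h2, oβ₁ := h3 }⟩

end TBA

namespace TBA

namespace Cfg'

variable {Δ : TBA} {a b l g s s' k σ β β₁ b' : Set Pt} {c u v x y y' z p q r w : Pt}

theorem base_mem (C : Δ.Cfg' a b l g β β₁ c u v w z) (hk : k ∈ Δ.Sbar) (h : Δ.Opp k u v) :
    k ≠ l ∧ ∃ y ∈ openSegment ℝ u v, y ∈ k := by
  obtain ⟨y, hy, -, hyk, -⟩ := cross_S C.T.hl C.T.hul C.T.hvl hk h
  exact ⟨(h.ne_of_mem (Or.inl hk) C.T.hul).symm, y, hy, hyk⟩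

theorem mem_l (C : Δ.Cfg' a b l g β β₁ c u v w z) (hy : y ∈ openSegment ℝ u v) : y ∈ l :=
  mid_mem (Or.inl C.T.hl) hy C.T.hul C.T.hvl

theorem opp_base (C : Δ.Cfg' a b l g β β₁ c u v w z) (hs : s ∈ Δ.Sbar ∪ Δ.B) (hsl : l ≠ s)
    (hy : y ∈ openSegment ℝ u v) (hys : y ∈ s) : Δ.Opp s u v :=
  opp_of_mid (Or.inl C.T.hl) hs hsl C.T.uv C.T.hul C.T.hvl hy hys

theorem not_in_apex (C : Δ.Cfg' a b l g β β₁ c u v w z) (hs : s ∈ Δ.Sbar) (hsl : s ≠ l)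
    (hy : y ∈ openSegment ℝ u v) (hys : y ∈ s) (h : Δ.Opp s c u)
    (hpm : p ∈ openSegment ℝ c u) (hpa : p ∈ a) (hps : p ∈ s) :
    Δ.Tri a s l p u y ∧ ¬ Δ.In p u y ∧ Δ.In u p y := by
  have T := C.T
  have hyl := C.mem_l hy
  have sS := opp_mem_S hs T.tc T.tu h
  have T' : Δ.Tri a s l p u y := ⟨T.ha, hs, T.hl, h.ne_of_mem (Or.inl hs) T.hca, T.hal, hsl,
    hpa, hps, T.hua, T.hul, hys, hyl⟩
  have zp := fn_eq_zero (Or.inl hs) hps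
  have zy := fn_eq_zero (Or.inl hs) hys
  refine ⟨T', C.ih T' C.aS sS (mu_lt (mid_hull hpm T.hc T.hu) T.hu (mid_hull hy T.hu T.hv) hs
    (Or.inl h) (not_opp_zero zp) (not_opp_zero zp) (not_opp_zero' zy)), β₁, C.β₁B, C.hu, ?_⟩
  have zu := fn_eq_zero (Or.inr C.β₁B) C.hu
  exact ((mid_sm_left hpm zu C.oβ₁.left).opp C.oβ₁).sm (mid_sm_right hy zu C.oβ₁.right).symm

/-- The blocking segment through a vertex on `uv` leaves the second initial segment on the side
of `v`. -/
theorem opp_left (C : Δ.Cfg' a b l g β β₁ c u v w z) (hs : s ∈ Δ.Sbar) (hsl : s ≠ l)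
    (hy : y ∈ openSegment ℝ u v) (hys : y ∈ s) (hb' : b' ∈ Δ.B) (hyb : y ∈ b') (hr : r ∈ s)
    (hrc : Δ.Sm l r c) : Δ.Opp b' u r := by
  have T := C.T
  have hyl := C.mem_l hy
  have zl := fn_eq_zero (Or.inl T.hl) hyl
  have zb := fn_eq_zero (Or.inr hb') hyb
  have osuv := C.opp_base (Or.inl hs) hsl.symm hy hys
  have obuv := C.opp_base (Or.inr hb') (B_ne hb' T.hl).symm hy hyb
  rcases osuv.symm.split (T.not_zero hs osuv) with h | h
  · obtain ⟨p, hpm, hpb, hps, -⟩ := cross_S T.hb T.hcb T.hvb hs h.symm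
    have T' : Δ.Tri b s l p v y := ⟨T.hb, hs, T.hl, h.symm.ne_of_mem (Or.inl hs) T.hcb, T.hbl, hsl,
      hpb, hps, T.hvb, T.hvl, hys, hyl⟩
    have zp := fn_eq_zero (Or.inl hs) hps
    have zy := fn_eq_zero (Or.inl hs) hys
    have h1 : ¬ Δ.In p v y := C.ih T' C.bS (opp_mem_S hs T.tc T.tv h.symm)
      (mu_lt (mid_hull hpm T.hc T.hv) T.hv (mid_hull hy T.hu T.hv) hs (Or.inr (Or.inl h.symm))
        (not_opp_zero zp) (not_opp_zero zp) (not_opp_zero' zy))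
    have h2 : ¬ Δ.In v p y := by
      rintro ⟨b'', hb'', hv'', ho⟩
      have zv := fn_eq_zero (Or.inr hb'') hv''
      exact C.hv ⟨b'', hb'', hv'', ((mid_sm_of_ne hpm zv ho.left).symm.opp ho).sm
        (mid_sm_of_ne hy zv ho.right)⟩
    have h3 : ¬ Δ.In y p v := by
      have := T'.parity
      tauto
    have nb : Δ.fn b' p ≠ 0 := not_mem_of_meet (Or.inl hs) (Or.inr hb') (B_ne hb' hs).symm hys hyb
      hps T'.cv
    have h4 : Δ.Sm b' p v := sm_of_not_opp nb obuv.right fun ho => h3 ⟨b', hb', hyb, ho⟩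
    have h5 : Δ.Sm l r p := hrc.trans
      (mid_sm_left hpm (fn_eq_zero (Or.inl T.hl) T.hvl) T.fc).symm
    exact obuv.sm ((ray_sm (Or.inl hs) hys hr hps zl h5 zb nb).trans h4).symm
  · obtain ⟨p, hpm, hpa, hps, -⟩ := cross_S T.ha T.hca T.hua hs h
    obtain ⟨T', h1, h2⟩ := C.not_in_apex hs hsl hy hys h hpm hpa hps
    obtain ⟨b'', hb'', hy'', ho⟩ : Δ.In y p u := by
      have := T'.parity
      tauto
    rw [block_eq hs T.hl hsl hys hyl hb'' hb' hy'' hyb] at ho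
    have h5 : Δ.Sm l r p := hrc.trans
      (mid_sm_left hpm (fn_eq_zero (Or.inl T.hl) T.hul) T.fc).symm
    exact ho.symm.sm (ray_sm (Or.inl hs) hys hr hps zl h5 zb ho.left).symm

theorem no_cross_aux (C : Δ.Cfg' a b l g β β₁ c u v w z) (hs : s ∈ Δ.Sbar) (hsl : s ≠ l)
    (hs' : s' ∈ Δ.Sbar) (hsl' : s' ≠ l) (hne : s ≠ s') (hy : y ∈ openSegment ℝ u v)
    (hys : y ∈ s) (hy' : y' ∈ openSegment ℝ u v) (hys' : y' ∈ s') (hqs : q ∈ s) (hqs' : q ∈ s')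
    (hq : q ∈ convexHull ℝ ({c, u, v} : Set Pt)) (hqc : Δ.Sm l q c)
    (hyy : y' ∈ openSegment ℝ y v) : False := by
  have T := C.T
  have hyl := C.mem_l hy
  have hyl' := C.mem_l hy'
  have osuv := C.opp_base (Or.inl hs) hsl.symm hy hys
  have osuv' := C.opp_base (Or.inl hs') hsl'.symm hy' hys'
  have sS := opp_mem_S hs T.tu T.tv osuv
  have sS' := opp_mem_S hs' T.tu T.tv osuv'
  have T' : Δ.Tri s s' l q y y' :=
    ⟨hs, hs', T.hl, hne, hsl, hsl', hqs, hqs', hys, hyl, hys', hyl'⟩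
  have zq := fn_eq_zero (Or.inl hs) hqs
  have zy := fn_eq_zero (Or.inl hs) hys
  have h1 : ¬ Δ.In q y y' := C.ih T' sS sS' (mu_lt hq (mid_hull hy T.hu T.hv)
    (mid_hull hy' T.hu T.hv) hs (Or.inr (Or.inr osuv)) (not_opp_zero zq) (not_opp_zero zq)
    (not_opp_zero zy))
  have h2 : ¬ Δ.In y q y' := by
    rintro ⟨b', hb', hyb, ho⟩
    have h3 := C.opp_left hs hsl hy hys hb' hyb hqs hqc
    have h4 := C.opp_base (Or.inr hb') (B_ne hb' T.hl).symm hy hyb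
    have h5 := h4.sm (mid_sm_right hyy (fn_eq_zero (Or.inr hb') hyb) h4.right).symm
    exact (h3.symm.trans h5).not_opp ho
  have h3 : Δ.In y' q y := by
    obtain ⟨b', hb', hyb⟩ := exists_block sS' T.hl hsl' hys' hyl'
    have h3 := C.opp_left hs' hsl' hy' hys' hb' hyb hqs' hqc
    have h4 := C.opp_base (Or.inr hb') (B_ne hb' T.hl).symm hy' hyb
    have hyv : y ≠ v := fun e => hsl (eq_of_two (Or.inl hs) (Or.inl T.hl) T'.cu hqs hys (by
      rw [e] at hyy; rw [openSegment_same] at hyy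
      exact absurd (hyy.trans e.symm) T'.uv.symm) hyl)
    have h5 := opp_of_mid (Or.inl T.hl) (Or.inr hb') (B_ne hb' T.hl).symm hyv hyl T.hvl hyy hyb
    exact ⟨b', hb', hyb, h3.symm.sm (h4.trans h5.symm)⟩
  have := T'.parity
  tauto

/-- Two initial segments through different vertices on `uv` do not meet inside the triangle. -/
theorem no_cross (C : Δ.Cfg' a b l g β β₁ c u v w z) (hs : s ∈ Δ.Sbar) (hsl : s ≠ l)
    (hs' : s' ∈ Δ.Sbar) (hsl' : s' ≠ l) (hne : s ≠ s') (hy : y ∈ openSegment ℝ u v)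
    (hys : y ∈ s) (hy' : y' ∈ openSegment ℝ u v) (hys' : y' ∈ s') (hqs : q ∈ s) (hqs' : q ∈ s')
    (hq : q ∈ convexHull ℝ ({c, u, v} : Set Pt)) (hqc : Δ.Sm l q c) : False := by
  have T := C.T
  have hyl := C.mem_l hy
  have hyl' := C.mem_l hy'
  have osuv := C.opp_base (Or.inl hs) hsl.symm hy hys
  have osuv' := C.opp_base (Or.inl hs') hsl'.symm hy' hys'
  have zy := fn_eq_zero (Or.inl hs) hys
  have zy' := fn_eq_zero (Or.inl hs') hys'
  have n : Δ.fn s' y ≠ 0 := fn_ne (Or.inl hs') (mem_tri (Or.inl hs) hys) fun h =>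
    conc hs T.hl hs' hsl hne hsl'.symm hys hyl h
  rcases osuv'.split n with h | h
  · have h1 := mid_of_opp (Or.inl T.hl) T.hul hyl hyl' zy' h
    have h2 := (mid_sm_left h1 zy osuv.left).opp osuv
    exact C.no_cross_aux hs' hsl' hs hsl hne.symm hy' hys' hy hys hqs' hqs hq hqc
      (mid_of_opp (Or.inl T.hl) hyl' T.hvl hyl zy h2)
  · exact C.no_cross_aux hs hsl hs' hsl' hne hy hys hy' hys' hqs hqs' hq hqc
      (mid_of_opp (Or.inl T.hl) hyl T.hvl hyl' zy' h)

theorem base_of_cw (C : Δ.Cfg' a b l g β β₁ c u v w z) (hk : k ∈ Δ.Sbar) (h : Δ.Opp k c w) :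
    Δ.Opp k u v := by
  have T := C.T
  have hka := h.ne_of_mem (Or.inl hk) T.hca
  have hkb := h.ne_of_mem (Or.inl hk) T.hcb
  have hkl := h.symm.ne_of_mem (Or.inl hk) C.hwl
  have nu := T.nu hk hka hkl
  have nv := T.nv hk hkb hkl
  rcases opp_or_sm h.left nu with h1 | h1
  · exact C.base hk h1
  rcases opp_or_sm h.left nv with h2 | h2
  · exact h1.symm.opp h2
  · exact absurd ((mid_sm C.hwm (h1.symm.trans h2)).trans h1.symm).symm h.not_sm

/-- No initial segment separates `c` from `w`. -/
theorem not_opp_cw (C : Δ.Cfg' a b l g β β₁ c u v w z) (hk : k ∈ Δ.Sbar) : ¬ Δ.Opp k c w := by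
  intro h
  have T := C.T
  obtain ⟨p, hp, hpk⟩ := exists_cross (Or.inl hk) h T.tc (mem_tri (Or.inl T.hl) C.hwl)
  have hpβ := mid_mem (Or.inr C.βB) hp C.cβ C.hwβ
  obtain ⟨k', hk', hne, hpk'⟩ := second hk C.βB hpk hpβ
  have h' := opp_of_mid (Or.inr C.βB) (Or.inl hk') (B_ne C.βB hk') h.ne C.cβ C.hwβ hp hpk'
  obtain ⟨hkl, y, hy, hyk⟩ := C.base_mem hk (C.base_of_cw hk h)
  obtain ⟨hkl', y', hy', hyk'⟩ := C.base_mem hk' (C.base_of_cw hk' h')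
  exact C.no_cross hk hkl hk' hkl' hne.symm hy hyk hy' hyk' hpk hpk'
    (mid_hull hp T.hc (mid_hull C.hwm T.hu T.hv))
    (mid_sm_left hp (fn_eq_zero (Or.inl T.hl) C.hwl) T.fc)

theorem sm_cw (C : Δ.Cfg' a b l g β β₁ c u v w z) (hk : k ∈ Δ.Sbar) (hkg : k ≠ g)
    (h : Δ.Opp k u v) : Δ.Sm k c w :=
  sm_of_not_opp (C.T.not_zero hk h) (fn_ne (Or.inl hk) (mem_tri (Or.inl C.T.hl) C.hwl)
    fun hw => conc C.T.hl (S_sub C.gS) hk C.hgl.symm (C.base_mem hk h).1.symm hkg.symm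
      C.hwl C.hwg hw) (C.not_opp_cw hk)

/-- No initial segment separates `c` from `u`. -/
theorem not_opp_cu (C : Δ.Cfg' a b l g β β₁ c u v w z) (hk : k ∈ Δ.Sbar) : ¬ Δ.Opp k c u := by
  intro h
  have T := C.T
  obtain ⟨hkl, y, hy, hyk⟩ := C.base_mem hk (C.base hk h)
  obtain ⟨p, hpm, hpa, hpk, -⟩ := cross_S T.ha T.hca T.hua hk h
  obtain ⟨T', h1, h2⟩ := C.not_in_apex hk hkl hy hyk h hpm hpa hpk
  refine T'.not_in (fun s hs hu hyy => ?_) h1 h2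
  have hcu := (mid_opp_right hpm hu).symm.opp hu
  obtain ⟨hsl, y', hy', hys⟩ := C.base_mem hs (C.base hs hcu)
  obtain ⟨q, hq, hqk, hqs, -⟩ := cross_S hk hpk hyk hs hyy
  have zl := fn_eq_zero (Or.inl T.hl) (C.mem_l hy)
  have h5 := mid_sm_left hpm (fn_eq_zero (Or.inl T.hl) T.hul) T.fc
  exact C.no_cross hk hkl hs hsl (hyy.ne_of_mem (Or.inl hs) hpk) hy hyk hy' hys hqk hqs
    (mid_hull hq (mid_hull hpm T.hc T.hu) (mid_hull hy T.hu T.hv))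
    ((mid_sm_left hq zl h5.left).trans h5)

theorem base_of_cv (C : Δ.Cfg' a b l g β β₁ c u v w z) (hk : k ∈ Δ.Sbar) (h : Δ.Opp k c v) :
    Δ.Opp k u v :=
  (sm_of_not_opp h.left (C.T.nu hk (h.ne_of_mem (Or.inl hk) C.T.hca)
    (h.symm.ne_of_mem (Or.inl hk) C.T.hvl)) (C.not_opp_cu hk)).symm.opp h

/-- Initial segments other than `g` separating `c` and `v` separate `z` and `v`. -/
theorem sm_cz (C : Δ.Cfg' a b l g β β₁ c u v w z) (hk : k ∈ Δ.Sbar) (hkg : k ≠ g)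
    (h : Δ.Opp k c v) : Δ.Sm k c z := by
  have T := C.T
  have hg := S_sub C.gS
  have hkb := h.ne_of_mem (Or.inl hk) T.hcb
  have nz : Δ.fn k z ≠ 0 := fn_ne (Or.inl hk) (mem_tri (Or.inl T.hb) C.hzb) fun hz =>
    conc T.hb hg hk C.hbg hkb hkg.symm C.hzb C.hzg hz
  have ouv := C.base_of_cv hk h
  have scw := C.sm_cw hk hkg ouv
  refine sm_of_not_opp h.left nz fun ho => ?_
  obtain ⟨hkl, y, hy, hyk⟩ := C.base_mem hk ouv
  obtain ⟨q, hq, hqg, hqk, -⟩ := cross_S hg C.hzg C.hwg hk (ho.symm.sm scw)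
  have h5 := mid_sm_left C.hzm (fn_eq_zero (Or.inl T.hl) T.hvl) T.fc
  exact C.no_cross hg C.hgl hk hkl hkg.symm C.hwm C.hwg hy hyk hqg hqk
    (mid_hull hq (mid_hull C.hzm T.hc T.hv) (mid_hull C.hwm T.hu T.hv))
    ((mid_sm_left hq (fn_eq_zero (Or.inl T.hl) C.hwl) h5.left).trans h5)

end Cfg'

end TBA

namespace TBA

namespace Cfg'

variable {Δ : TBA} {a b l g s s' k σ β β₁ b' : Set Pt} {c u v x y y' z p q r w : Pt}

/-- Only `g` separates `c` and `v`. -/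
theorem eq_of_opp_cv (C : Δ.Cfg' a b l g β β₁ c u v w z) (hk₀ : k ∈ Δ.Sbar)
    (ho₀ : Δ.Opp k c v) : k = g := by
  by_contra hne₀
  have T := C.T
  have hg := S_sub C.gS
  have zg := fn_eq_zero (Or.inl hg) C.hzg
  choose! f hf1 hf2 hf3 hf4 using fun k (hk : k ∈ Δ.Sbar ∧ Δ.Opp k c v) =>
    cross_S T.hb T.hcb T.hvb hk.1 hk.2
  obtain ⟨k, ⟨⟨hk, ho⟩, hkg⟩, hmin⟩ := exists_min_image
    {k | (k ∈ Δ.Sbar ∧ Δ.Opp k c v) ∧ k ≠ g} (fun k => |Δ.fn g (f k)|)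
    (finSbar.subset fun k hk => hk.1.1) ⟨k, ⟨hk₀, ho₀⟩, hne₀⟩
  obtain ⟨hpm, hpb, hpk⟩ : f k ∈ openSegment ℝ c v ∧ f k ∈ b ∧ f k ∈ k :=
    ⟨hf1 k ⟨hk, ho⟩, hf2 k ⟨hk, ho⟩, hf3 k ⟨hk, ho⟩⟩
  have ouv := C.base_of_cv hk ho
  obtain ⟨hkl, y, hy, hyk⟩ := C.base_mem hk ouv
  have hyl := C.mem_l hy
  have scz := C.sm_cz hk hkg ho
  have ozv := scz.symm.opp ho
  have zk := fn_eq_zero (Or.inl hk) hpk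
  have hpz : f k ∈ openSegment ℝ z v := mid_of_opp (Or.inl T.hb) C.hzb T.hvb hpb zk ozv
  have owv := (C.sm_cw hk hkg ouv).symm.opp ho
  obtain ⟨b', hb', hyb⟩ := exists_block (opp_mem_S hk T.tc T.tv ho) T.hl hkl hyk hyl
  have h1 := C.opp_left hk hkl hy hyk hb' hyb hpk
    (mid_sm_left hpm (fn_eq_zero (Or.inl T.hl) T.hvl) T.fc)
  have h2 := C.opp_base (Or.inr hb') (B_ne hb' T.hl).symm hy hyb
  have h3 : Δ.Sm b' v (f k) := h2.symm.trans h1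
  have h4 : Δ.Opp b' w v := opp_of_mid (Or.inl T.hl) (Or.inr hb') (B_ne hb' T.hl).symm owv.ne
    C.hwl T.hvl (mid_of_opp (Or.inl T.hl) C.hwl T.hvl hyl (fn_eq_zero (Or.inl hk) hyk) owv) hyb
  have h5 : Δ.fn b' z ≠ 0 := fun h0 => C.hz ⟨b', hb', (mem_iff (Or.inr hb')).2
    ⟨mem_tri (Or.inl T.hb) C.hzb, h0⟩, h4.symm⟩
  rcases opp_or_sm h5 h3.right with h6 | h6
  · obtain ⟨q, hq, hqb, hqb', s, hs, hsb, hqs, hso⟩ := cross_B T.hb C.hzb hpb hb' h6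
    have s1 : Δ.Opp s z v := hso.sm (mid_opp_left hpz hso)
    have s2 : Δ.Opp s c v := (mid_opp_right C.hzm s1).symm.opp s1
    have hsg : s ≠ g := by rintro rfl; exact hso.left zg
    have e : f s = q := meet_eq (Or.inl T.hb) (Or.inl hs) hsb.symm (hf2 s ⟨hs, s2⟩)
      (hf3 s ⟨hs, s2⟩) hqb hqs
    have hle := hmin s ⟨⟨hs, s2⟩, hsg⟩
    simp only [e] at hle
    obtain ⟨t, t', ht, ht', htt, hv⟩ := mid_val (Δ := Δ) hq
    have n : Δ.fn g (f k) ≠ 0 := not_mem_of_meet (Or.inl T.hb) (Or.inl hg) C.hbg C.hzb C.hzg hpb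
      hso.ne.symm
    rw [hv g, zg, mul_zero, zero_add, abs_mul, abs_of_pos ht'] at hle
    have := abs_pos.2 n
    nlinarith
  · obtain ⟨q, hq, hqg, -, s, hs, hsg, hqs, hso⟩ := cross_B hg C.hwg C.hzg hb'
      ((h4.sm h3).sm h6.symm)
    have nv : ¬ Δ.Opp s c v := fun h =>
      ((C.sm_cw hs hsg (C.base_of_cv hs h)).symm.trans (C.sm_cz hs hsg h)).not_opp hso
    rcases hull_opp (mid_hull C.hwm T.hu T.hv) (mid_hull C.hzm T.hc T.hv) hso with h | h | h
    · exact C.not_opp_cu hs h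
    · exact nv h
    · rcases h.split (T.not_zero hs h) with h | h
      · exact C.not_opp_cu hs h.symm
      · exact nv h

theorem eq_of_opp (C : Δ.Cfg' a b l g β β₁ c u v w z) (hk : k ∈ Δ.Sbar)
    (hx : x ∈ convexHull ℝ ({c, u, v} : Set Pt)) (hy : y ∈ convexHull ℝ ({c, u, v} : Set Pt))
    (h : Δ.Opp k x y) : k = g := by
  rcases hull_opp hx hy h with h | h | h
  · exact (C.not_opp_cu hk h).elim
  · exact C.eq_of_opp_cv hk h
  · exact (h.split (C.T.not_zero hk h)).elim (fun h => (C.not_opp_cu hk h.symm).elim)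
      (C.eq_of_opp_cv hk)

theorem z_mem (C : Δ.Cfg' a b l g β β₁ c u v w z) : z ∈ β₁ := by
  have T := C.T
  obtain ⟨q, -, hqb, hqβ, s, hs, -, hqs, ho⟩ := cross_B T.hb T.hcb T.hvb C.β₁B C.oβ₁
  rw [C.eq_of_opp_cv hs ho] at hqs
  rwa [meet_eq (Or.inl T.hb) (Or.inl (S_sub C.gS)) C.hbg C.hzb C.hzg hqb hqs]

theorem impossible (C : Δ.Cfg' a b l g β β₁ c u v w z) (hstrong : Δ.Strong) : False := by
  have T := C.T
  have hg := S_sub C.gS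
  have zu := fn_eq_zero (Or.inl T.ha) T.hua
  have zbv := fn_eq_zero (Or.inl T.hb) T.hvb
  have zbz := fn_eq_zero (Or.inl T.hb) C.hzb
  have hzβ := C.z_mem
  have hzh := mid_hull C.hzm T.hc T.hv
  have ogu := C.opp_base (Or.inl hg) C.hgl.symm C.hwm C.hwg
  have sbw := mid_sm_left C.hwm zbv T.fu
  obtain ⟨q₁, hq₁, hzq⟩ := exists_beyond (Or.inr C.β₁B) hzβ C.hu
    (not_on_edge C.bS C.gS C.hbg C.hzb C.hzg)
  have obq := mid_opp hzq zbz T.fu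
  have ogq := mid_opp hzq (fn_eq_zero (Or.inl hg) C.hzg) ogu.left
  have hqz : q₁ ≠ z := fun e => obq.right (e ▸ zbz)
  obtain ⟨p₀, hpβ, hgen, hzc, hpg, hpb, hother⟩ :=
    exists_face C.β₁B hg T.hb C.hbg.symm hzβ C.hzg C.hzb hq₁ hqz
  have hvc : v ∈ Δ.cell p₀ := fun σ hσ => by
    by_cases h1 : σ = g
    · rw [h1]; exact (hpg.trans (ogq.symm.trans ogu)).le
    by_cases h2 : σ = b
    · rw [h2, zbv, mul_zero]
    exact (hother σ hσ h1 h2).nonneg_of_not_opp fun h => h1 (C.eq_of_opp hσ hzh T.hv h)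
  obtain ⟨z', hzz, hzg', hzc', s₂, hs₂, hne₂, hzs⟩ :=
    exists_next hgen hzc hg T.hb C.hbg.symm C.hzg C.hzb
  have hzb' : Δ.fn b z' ≠ 0 := not_mem_of_meet (Or.inl hg) (Or.inl T.hb) C.hbg.symm C.hzg C.hzb
    hzg' hzz
  have obz : Δ.Opp b u z' := obq.sm (hpb.symm.trans (cell_sm T.hb hgen hzc' hzb'))
  obtain ⟨q, hqβ, hq2, hql⟩ := hstrong.concurrent C.β₁B hpβ hgen hg T.hb hs₂ T.hl C.hbg.symm hne₂
    T.hbl.symm hzβ C.hzg C.hzb hzg' hzs T.hvb T.hvl hzc hzc' hvc hzz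
    (fun e => ogu.right (e ▸ fn_eq_zero (Or.inl hg) C.hzg)) C.hu T.hul
  have hqu := meet_eq (Or.inr C.β₁B) (Or.inl T.hl) (B_ne C.β₁B T.hl) hqβ hql C.hu T.hul
  have hza : z' ∈ a := by
    by_cases h1 : s₂ = l
    · have e := meet_eq (Or.inl hg) (Or.inl T.hl) C.hgl hzg' (h1 ▸ hzs) C.hwg C.hwl
      exact absurd (e ▸ obz).symm sbw.not_opp
    by_cases h2 : s₂ = a
    · exact h2 ▸ hzs
    exact (conc T.ha T.hl hs₂ T.hal (Ne.symm h2) (Ne.symm h1) T.hua T.hul (hqu ▸ hq2)).elim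
  obtain ⟨q₂, hq₂, hcq⟩ := exists_beyond (Or.inr C.βB) C.cβ C.hwβ
    (not_on_edge C.aS C.bS T.hab T.hca T.hcb)
  have zac := fn_eq_zero (Or.inl T.ha) T.hca
  have zbc := fn_eq_zero (Or.inl T.hb) T.hcb
  have saw := mid_sm_right C.hwm zu T.fv
  have oaq := mid_opp hcq zac saw.left
  have obq₂ := mid_opp hcq zbc sbw.left
  obtain ⟨p₁, hpβ', hgen', hcc, hpb', hpa', hother'⟩ :=
    exists_face C.βB T.hb T.ha T.hab.symm C.cβ T.hcb T.hca hq₂ (fun e => oaq.right (e ▸ zac))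
  have hzc'' : z' ∈ Δ.cell p₁ := fun σ hσ => by
    by_cases h1 : σ = b
    · rw [h1]; exact (hpb'.trans (obq₂.symm.trans (sbw.opp obz))).le
    by_cases h2 : σ = a
    · rw [h2, fn_eq_zero (Or.inl T.ha) hza, mul_zero]
    refine (hother' σ hσ h1 h2).nonneg_of_not_opp fun h => ?_
    have h3 : σ ≠ g := by rintro rfl; exact h.right (fn_eq_zero (Or.inl hσ) hzg')
    have h4 : Δ.fn σ z ≠ 0 := fn_ne (Or.inl hσ) (mem_tri (Or.inl T.hb) C.hzb) fun hz =>
      conc T.hb hg hσ C.hbg (Ne.symm h1) h3.symm C.hzb C.hzg hz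
    rcases opp_or_sm h.left h4 with h5 | h5
    · exact h3 (C.eq_of_opp hσ T.hc hzh h5)
    · exact cell_not_opp hgen hσ hzc hzc' (h5.symm.opp h)
  obtain ⟨v₂, hvv, hvb, hvc₂, s₃, hs₃, hne₃, hvs⟩ :=
    exists_next hgen' hcc T.hb T.ha T.hab.symm T.hcb T.hca
  obtain ⟨q', hqβ', hq3, hqg⟩ := hstrong.concurrent C.βB hpβ' hgen' T.hb T.ha hs₃ hg T.hab.symm
    hne₃ C.hag.symm C.cβ T.hcb T.hca hvb hvs hza hzg' hcc hvc₂ hzc'' hvv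
    (fun e => obz.right (e ▸ zbc)) C.hwβ C.hwg
  have hqw := meet_eq (Or.inr C.βB) (Or.inl hg) (B_ne C.βB hg) hqβ' hqg C.hwβ C.hwg
  have key : ∀ x, x = v₂ → Δ.Sm a x v → False := fun x e h =>
    cell_not_opp hgen' T.ha (openCell_subset_cell (mem_openCell hgen')) (e ▸ hvc₂)
      (hpa'.opp (oaq.symm.sm (saw.trans h.symm)))
  by_cases h1 : s₃ = l
  · exact key v (meet_eq (Or.inl T.hb) (Or.inl T.hl) T.hbl T.hvb T.hvl hvb (h1 ▸ hvs))
      (sm_refl T.fv)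
  by_cases h2 : s₃ = g
  · exact key z (meet_eq (Or.inl T.hb) (Or.inl hg) C.hbg C.hzb C.hzg hvb (h2 ▸ hvs))
      (mid_sm_right C.hzm zac T.fv)
  exact conc hg T.hl hs₃ C.hgl (Ne.symm h2) (Ne.symm h1) C.hwg C.hwl (hqw ▸ hq3)

end Cfg'

/-- A corner between two proper sides of a triangle is not internally blocked. -/
theorem Tri.not_blocked {Δ : TBA} (hstrong : Δ.Strong) {a b l : Set Pt} {c u v : Pt}
    (T : Δ.Tri a b l c u v) (ha : a ∈ Δ.S) (hb : b ∈ Δ.S) : ¬ Δ.In c u v := by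
  induction hn : Δ.mu c u v using Nat.strong_induction_on generalizing a b l c u v with
  | _ n ih =>
  subst hn
  rintro ⟨β, hβ, hcβ, ho⟩
  have C : Δ.Cfg a b l β c u v := ⟨T, ha, hb, fun T' ha' hb' hm => ih _ hm T' ha' hb' rfl, hβ,
    hcβ, ho⟩
  obtain ⟨w, hw, hwl, hwβ, g, hg, hgl, hwg, hgo⟩ := cross_B T.hl T.hul T.hvl hβ ho
  rcases hgo.split (T.not_zero hg hgo) with h | h
  · obtain ⟨z, β₁, C'⟩ := C.swap.exists_cfg' hg hgl (mid_symm hw) hwl hwg hwβ hgo.symm h.symm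
    exact C'.impossible hstrong
  · obtain ⟨z, β₁, C'⟩ := C.exists_cfg' hg hgl hw hwl hwg hwβ hgo h
    exact C'.impossible hstrong

end TBA

namespace TBA

variable {Δ : TBA} {a b e f l r : Set Pt} {c u v x y y' u₁ u₂ v₁ v₂ : Pt}

theorem Tri.sm_of_not_in {m : Set Pt} (T : Δ.Tri a b l c u v) (h : ¬ Δ.In c u v) (hm : m ∈ Δ.B)
    (hc : c ∈ m) : Δ.Sm m u v :=
  sm_of_not_opp
    (not_mem_of_meet (Or.inl T.ha) (Or.inr hm) (B_ne hm T.ha).symm T.hca hc T.hua T.cu.symm)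
    (not_mem_of_meet (Or.inl T.hb) (Or.inr hm) (B_ne hm T.hb).symm T.hcb hc T.hvb T.cv.symm)
    fun ho => h ⟨m, hm, hc, ho⟩

/-- Two proper initial segments `a = u₁u₂` and `b = v₁v₂` between the edges `e` and `f`, which
share the corner `x`, crossing at `c`, with `u₁` and `v₂` the endpoints next to `x`. -/
structure Cross (Δ : TBA) (a b e f : Set Pt) (c x u₁ v₁ u₂ v₂ : Pt) : Prop where
  aS : a ∈ Δ.S
  bS : b ∈ Δ.S
  T₁ : Δ.Tri a b e c u₁ v₁
  T₂ : Δ.Tri a b f c u₂ v₂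
  hef : e ≠ f
  hxe : x ∈ e
  hxf : x ∈ f
  hu : u₁ ∈ openSegment ℝ v₁ x
  hv : v₂ ∈ openSegment ℝ u₂ x
  hca : c ∈ openSegment ℝ u₁ u₂
  hcb : c ∈ openSegment ℝ v₁ v₂

namespace Cross

theorem mirror (C : Δ.Cross a b e f c x u₁ v₁ u₂ v₂) : Δ.Cross b a f e c x v₂ u₂ v₁ u₁ :=
  ⟨C.bS, C.aS, C.T₂.swap, C.T₁.swap, C.hef.symm, C.hxf, C.hxe, C.hv, C.hu, mid_symm C.hcb,
    mid_symm C.hca⟩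

theorem corner (C : Δ.Cross a b e f c x u₁ v₁ u₂ v₂) : Δ.Tri e f a x u₁ u₂ :=
  ⟨C.T₁.hl, C.T₂.hl, C.T₁.ha, C.hef, C.T₁.hal.symm, C.T₂.hal.symm, C.hxe, C.hxf, C.T₁.hul,
    C.T₁.hua, C.T₂.hul, C.T₂.hua⟩

/-- No initial segment cuts off the corner `c` of the triangle `c u₂ v₂`. -/
theorem not_cut (hstrong : Δ.Strong) (C : Δ.Cross a b e f c x u₁ v₁ u₂ v₂) (hr : r ∈ Δ.Sbar)
    (hu : Δ.Opp r c u₂) : ¬ Δ.Opp r c v₂ := fun hv => by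
  obtain ⟨aS, bS, T₁, T₂, hef, hxe, hxf, hu₁, hv₂, hca, hcb⟩ := id C
  have rS := opp_mem_S hr T₂.tc T₂.tu hu
  obtain ⟨y', hy', hya, hyr, -⟩ := cross_S T₂.ha T₂.hca T₂.hua hr hu
  obtain ⟨v, hvm, hvb, hvr, -⟩ := cross_S T₂.hb T₂.hcb T₂.hvb hr hv
  have hra : r ≠ a := (hu.ne_of_mem (Or.inl hr) T₂.hca).symm
  have hrb : r ≠ b := (hv.ne_of_mem (Or.inl hr) T₂.hcb).symm
  have hyx : Δ.Sm b y' u₂ := mid_sm_right hy' (fn_eq_zero (Or.inl T₂.hb) T₂.hcb) T₂.fu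
  have s₁ : Δ.Sm r c u₁ := mid_opp_right hca hu
  have T : Δ.Tri r b a v y' c := ⟨hr, T₂.hb, T₂.ha, hrb, hra, T₂.hab.symm, hvr, hvb, hyr, hya,
    T₂.hcb, T₂.hca⟩
  have hbx : Δ.Opp b u₂ x := mid_opp hv₂ (fn_eq_zero (Or.inl T₂.hb) T₂.hvb) T₂.fu
  have zbv := fn_eq_zero (Or.inl T₂.hb) T₂.hvb
  have zbv₁ := fn_eq_zero (Or.inl T₁.hb) T₁.hvb
  have bx₁ : Δ.Sm b u₁ x := mid_sm_right hu₁ zbv₁ hbx.right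
  have between (y : Pt) (hy : y ∈ r) (h : Δ.Sm b y x) : v ∈ openSegment ℝ y' y :=
    mid_of_opp (Or.inl hr) hyr hy hvr (fn_eq_zero (Or.inl T₂.hb) hvb)
      ((hyx.opp hbx).sm h.symm)
  have hx : Δ.fn r x ≠ 0 := fn_ne (Or.inl hr) (mem_tri (Or.inl T₁.hl) hxe) fun h => by
    refine conc T₁.hl T₂.hl hr hef ?_ ?_ hxe hxf h
    · rintro rfl
      exact s₁.right (fn_eq_zero (Or.inl hr) T₁.hul)
    · rintro rfl
      exact hv.right (fn_eq_zero (Or.inl hr) T₂.hvl)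
  rcases (s₁.symm.opp hv).split hx with h | h
  · obtain ⟨y, hym, hye, hyr', -⟩ := cross_S T₁.hl T₁.hul hxe hr h
    have hre : r ≠ e := (h.ne_of_mem (Or.inl hr) T₁.hul).symm
    obtain ⟨m, hm, hvm'⟩ := exists_block rS T₂.hb hrb hvr hvb
    have T' : Δ.Tri r b e v y v₁ := ⟨hr, T₁.hb, T₁.hl, hrb, hre, T₁.hbl, hvr, hvb, hyr', hye,
      T₁.hvb, T₁.hvl⟩
    have h1 := T'.sm_of_not_in (T'.not_blocked hstrong rS bS) hm hvm'
    have h2 := T.sm_of_not_in (T.not_blocked hstrong rS bS) hm hvm'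
    have h3 : Δ.Opp m c v₂ := mid_opp hvm (fn_eq_zero (Or.inr hm) hvm') h2.right
    have h4 : Δ.Sm m c v₁ := mid_opp_right hcb h3
    have h5 : Δ.Opp m y' y := mid_opp (between y hyr' ((mid_sm hym bx₁).trans bx₁))
      (fn_eq_zero (Or.inr hm) hvm') h2.left
    exact h5.not_sm (h2.trans (h4.trans h1.symm))
  · obtain ⟨y, hym, hyf, hyr', -⟩ := cross_S T₂.hl hxf T₂.hvl hr h
    have hrf : r ≠ f := (h.ne_of_mem (Or.inl hr) hxf).symm
    obtain ⟨m, hm, hym'⟩ := exists_block rS T₂.ha hra hyr hya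
    have T' : Δ.Tri r a f y' y u₂ := ⟨hr, T₂.ha, T₂.hl, hra, hrf, T₂.hal, hyr, hya, hyr', hyf,
      T₂.hua, T₂.hul⟩
    have T'' : Δ.Tri r a b y' v c := T.rot.swap
    have h1 := T'.sm_of_not_in (T'.not_blocked hstrong rS aS) hm hym'
    have h2 := T''.sm_of_not_in (T''.not_blocked hstrong rS aS) hm hym'
    have h3 : Δ.Opp m c u₂ := mid_opp hy' (fn_eq_zero (Or.inr hm) hym') h2.right
    have h4 : Δ.Sm m v y := mid_sm_right (between y hyr' (mid_sm_left hym zbv hbx.right))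
      (fn_eq_zero (Or.inr hm) hym') h1.left
    exact h3.not_sm (h2.symm.trans (h4.trans h1))

theorem not_in (hstrong : Δ.Strong) (C : Δ.Cross a b e f c x u₁ v₁ u₂ v₂) :
    ¬ Δ.In u₂ c v₂ ∧ ¬ Δ.In v₂ c u₂ := by
  have h := C.T₂.not_blocked hstrong C.aS C.bS
  exact ⟨C.T₂.not_in (fun _ hr => C.not_cut hstrong hr) h,
    C.T₂.swap.not_in (fun _ hr h₁ h₂ => C.not_cut hstrong hr h₂ h₁) fun h' => h h'.symm⟩

theorem corner_blocked (hstrong : Δ.Strong) (C : Δ.Cross a b e f c x u₁ v₁ u₂ v₂) :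
    ∃ β ∈ Δ.B, x ∈ β ∧ Δ.Opp β u₁ v₂ := by
  obtain ⟨n₂, -⟩ := C.not_in hstrong
  obtain ⟨-, n₁⟩ := C.mirror.not_in hstrong
  have T := C.corner
  have h₁ : Δ.In u₁ x u₂ := by
    obtain ⟨m, hm, hum⟩ := exists_block C.aS C.T₁.hl C.T₁.hal C.T₁.hua C.T₁.hul
    have z := fn_eq_zero (Or.inr hm) hum
    have s₁ := C.T₁.rot.swap.sm_of_not_in n₁ hm hum
    have s₂ : Δ.Sm m c u₂ := mid_sm_right C.hca z
      (not_mem_of_meet (Or.inl T.hl) (Or.inr hm) (B_ne hm T.hl).symm T.hul hum T.hvl T.uv.symm)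
    exact ⟨m, hm, hum, (mid_opp C.hu z s₁.right).symm.sm (s₁.symm.trans s₂)⟩
  have h₂ : ¬ Δ.In u₂ x u₁ := by
    rintro ⟨m, hm, hum, ho⟩
    have z := fn_eq_zero (Or.inr hm) hum
    have s₁ := C.T₂.rot.swap.sm_of_not_in n₂ hm hum
    have s₂ : Δ.Sm m c u₁ := mid_sm_left C.hca z ho.right
    have s₃ : Δ.Sm m v₂ x := mid_sm_right C.hv z ho.left
    exact ho.not_sm (s₃.symm.trans (s₁.symm.trans s₂))
  obtain ⟨β, hβ, hx, ho⟩ := T.parity.2 fun h => h₂ (h.1 h₁)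
  exact ⟨β, hβ, hx, ho.sm (mid_sm_left C.hv (fn_eq_zero (Or.inr hβ) hx) ho.right).symm⟩

theorem crossing_blocked (hstrong : Δ.Strong) (C : Δ.Cross a b e f c x u₁ v₁ u₂ v₂) :
    ∃ β ∈ Δ.B, c ∈ β ∧ Δ.Opp β u₁ v₂ := by
  obtain ⟨β, hβ, hc⟩ := exists_block C.aS C.T₁.hb C.T₁.hab C.T₁.hca C.T₁.hcb
  have h := C.T₁.sm_of_not_in (C.T₁.not_blocked hstrong C.aS C.bS) hβ hc
  exact ⟨β, hβ, hc, h.opp (mid_opp C.hcb (fn_eq_zero (Or.inr hβ) hc) h.right)⟩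

end Cross

theorem mem_interior_hull3 {x y z p q : Pt} (h : cross x y z ≠ 0) (hq : q ∈ openSegment ℝ y z)
    (hp : p ∈ openSegment ℝ x q) : p ∈ interior (convexHull ℝ ({x, y, z} : Set Pt)) := by
  have hcont (u v : Pt) : Continuous (cross u v) := by unfold cross; fun_prop
  let U : Set Pt := {p | 0 < cross x y p * cross x y z} ∩ {p | 0 < cross y z p * cross x y z} ∩
    {p | 0 < cross z x p * cross x y z}
  have hU : IsOpen U := ((isOpen_lt continuous_const ((hcont _ _).mul continuous_const)).inter
    (isOpen_lt continuous_const ((hcont _ _).mul continuous_const))).inter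
    (isOpen_lt continuous_const ((hcont _ _).mul continuous_const))
  refine interior_maximal (fun p hp => (mem_hull3_iff_cross h p).2
    ⟨hp.1.1.le, hp.1.2.le, hp.2.le⟩) hU ?_
  obtain ⟨s, t, hs, ht, hst, rfl⟩ := hq
  obtain ⟨s', t', hs', ht', hst', rfl⟩ := hp
  have hpos : 0 < cross x y z * cross x y z := mul_self_pos.2 h
  have e1 : s' • x + t' • (s • y + t • z) = s' • x + (t' * s) • y + (t' * t) • z := by
    rw [smul_add, smul_smul, smul_smul, add_assoc]
  have hsum : s' + t' * s + t' * t = 1 := by rw [add_assoc, ← mul_add, hst, mul_one, hst']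
  rw [e1]
  refine ⟨⟨?_, ?_⟩, ?_⟩ <;> simp only [mem_ofPred_eq]
  · rw [cross_comb _ _ _ _ _ hsum]
    have : cross x y x = 0 ∧ cross x y y = 0 := by constructor <;> simp only [cross] <;> ring
    rw [this.1, this.2]
    nlinarith [mul_pos (mul_pos ht' ht) hpos]
  · rw [cross_comb _ _ _ _ _ hsum]
    have : cross y z x = cross x y z ∧ cross y z y = 0 ∧ cross y z z = 0 := by
      refine ⟨?_, ?_, ?_⟩ <;> simp only [cross] <;> ring
    rw [this.1, this.2.1, this.2.2]
    nlinarith [mul_pos hs' hpos]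
  · rw [cross_comb _ _ _ _ _ hsum]
    have : cross z x x = 0 ∧ cross z x y = cross x y z ∧ cross z x z = 0 := by
      refine ⟨?_, ?_, ?_⟩ <;> simp only [cross] <;> ring
    rw [this.1, this.2.1, this.2.2]
    nlinarith [mul_pos (mul_pos ht' hs) hpos]

/-- A corner `x` of a triangle in `Q` is internally blocked in `Q` if its blocking segment
separates the other two corners. -/
theorem internallyBlocked_of_opp {σ β Q : Set Pt} {y z : Pt} (hσ : σ ∈ Δ.Sbar) (hβ : β ∈ Δ.B)
    (hxσ : x ∈ σ) (hyσ : y ∈ σ) (hz : Δ.fn σ z ≠ 0) (hzT : z ∈ Δ.tri) (hxβ : x ∈ β)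
    (ho : Δ.Opp β y z) (hQ : convexHull ℝ {x, y, z} ⊆ Q) : Δ.InternallyBlocked Q x := by
  obtain ⟨q, hq, hqβ⟩ := exists_cross (Or.inr hβ) ho (mem_tri (Or.inl hσ) hyσ) hzT
  have hxy : x ≠ y := by rintro rfl; exact ho.left (fn_eq_zero (Or.inr hβ) hxβ)
  have hne : cross x y z ≠ 0 := fun h0 => by
    obtain ⟨t, rfl⟩ := exists_of_cross_eq_zero hxy h0
    exact hz (by rw [fn_ray, fn_eq_zero (Or.inl hσ) hxσ, fn_eq_zero (Or.inl hσ) hyσ]; ring)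
  have hp : (1 / 2 : ℝ) • x + (1 / 2 : ℝ) • q ∈ openSegment ℝ x q :=
    ⟨1 / 2, 1 / 2, by norm_num, by norm_num, by norm_num, rfl⟩
  exact ⟨β, hβ, hxβ, _, mid_mem (Or.inr hβ) hp hxβ hqβ,
    interior_mono hQ (mem_interior_hull3 hne hq hp)⟩

end TBA

/-- Lemma 12: if proper initial segments `a₁a₂` and `b₁b₂`, with `x₁, b₁, a₁, x₂` in this
order on `x₁x₂` and `x₃, a₂, b₂, x₂` in this order on `x₂x₃`, intersect at `c`, then in the
quadrilateral region `Q = a₁ x₂ b₂ c` the vertices `x₂` and `c` are internally blocked. -/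
theorem TBA.S12_basic_intersection (Δ : TBA) (hstrong : Δ.Strong)
    (a₁ b₁ a₂ b₂ c : Pt)
    (hord₁ : Sbtw ℝ Δ.x1 b₁ a₁ ∧ Sbtw ℝ b₁ a₁ Δ.x2)
    (hord₂ : Sbtw ℝ Δ.x3 a₂ b₂ ∧ Sbtw ℝ a₂ b₂ Δ.x2)
    (ha₁ : a₁ ∈ segment ℝ Δ.x1 Δ.x2) (hb₁ : b₁ ∈ segment ℝ Δ.x1 Δ.x2)
    (ha₂ : a₂ ∈ segment ℝ Δ.x2 Δ.x3) (hb₂ : b₂ ∈ segment ℝ Δ.x2 Δ.x3)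
    (hA : segment ℝ a₁ a₂ ∈ Δ.S) (hB : segment ℝ b₁ b₂ ∈ Δ.S)
    (hc : c ∈ segment ℝ a₁ a₂ ∩ segment ℝ b₁ b₂)
    (Q : Set Pt) (hQreg : Δ.IsRegion Q)
    (hQ : Q = convexHull ℝ {a₁, Δ.x2, b₂, c}) :
    Δ.InternallyBlocked Q Δ.x2 ∧ Δ.InternallyBlocked Q c := by
  have mid {x y z : Pt} (h : Sbtw ℝ x y z) : y ∈ openSegment ℝ x z :=
    mem_openSegment_of_ne_left_right h.2.1.symm h.2.2.symm (mem_segment_iff_wbtw.2 h.1)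
  have he : segment ℝ Δ.x1 Δ.x2 ∈ Δ.Sbar := Or.inr (by simp [triEdges])
  have hf : segment ℝ Δ.x2 Δ.x3 ∈ Δ.Sbar := Or.inr (by simp [triEdges])
  have hedge {s : Set Pt} (hs : s ∈ Δ.S) :
      s ≠ segment ℝ Δ.x1 Δ.x2 ∧ s ≠ segment ℝ Δ.x2 Δ.x3 :=
    ⟨fun h => TBA.S_not_edge hs (h ▸ by simp [triEdges]),
      fun h => TBA.S_not_edge hs (h ▸ by simp [triEdges])⟩
  have ha := left_mem_segment ℝ a₁ a₂
  have ha' := right_mem_segment ℝ a₁ a₂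
  have hb := left_mem_segment ℝ b₁ b₂
  have hb' := right_mem_segment ℝ b₁ b₂
  have hab : segment ℝ a₁ a₂ ≠ segment ℝ b₁ b₂ := fun h =>
    (hedge hA).1 (TBA.eq_of_two (Or.inl (TBA.S_sub hA)) (Or.inl he) hord₁.2.2.1 ha
      (h ▸ hb) ha₁ hb₁)
  have T₁ : Δ.Tri (segment ℝ a₁ a₂) (segment ℝ b₁ b₂) (segment ℝ Δ.x1 Δ.x2) c a₁ b₁ :=
    ⟨TBA.S_sub hA, TBA.S_sub hB, he, hab, (hedge hA).1, (hedge hB).1, hc.1, hc.2, ha, ha₁, hb, hb₁⟩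
  have T₂ : Δ.Tri (segment ℝ a₁ a₂) (segment ℝ b₁ b₂) (segment ℝ Δ.x2 Δ.x3) c a₂ b₂ :=
    ⟨TBA.S_sub hA, TBA.S_sub hB, hf, hab, (hedge hA).2, (hedge hB).2, hc.1, hc.2, ha', ha₂, hb',
      hb₂⟩
  have C : Δ.Cross (segment ℝ a₁ a₂) (segment ℝ b₁ b₂) (segment ℝ Δ.x1 Δ.x2)
      (segment ℝ Δ.x2 Δ.x3) c Δ.x2 a₁ b₁ a₂ b₂ :=
    ⟨hA, hB, T₁, T₂, Δ.edge12_ne_23, right_mem_segment ℝ _ _, left_mem_segment ℝ _ _,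
      mid hord₁.2, mid hord₂.2,
      mem_openSegment_of_ne_left_right T₁.cu.symm T₂.cu.symm hc.1,
      mem_openSegment_of_ne_left_right T₁.cv.symm T₂.cv.symm hc.2⟩
  obtain ⟨β, hβ, hx, ho⟩ := C.corner_blocked hstrong
  obtain ⟨γ, hγ, hcγ, ho'⟩ := C.crossing_blocked hstrong
  have hsub (x : Pt) (h : x = Δ.x2 ∨ x = c) : convexHull ℝ {x, a₁, b₂} ⊆ Q := by
    rw [hQ]
    refine convexHull_mono ?_
    rcases h with rfl | rfl <;> simp [insert_subset_iff]
  exact ⟨TBA.internallyBlocked_of_opp he hβ C.hxe ha₁ C.mirror.corner.fu T₂.tv hx ho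
      (hsub _ (.inl rfl)),
    TBA.internallyBlocked_of_opp (TBA.S_sub hA) hγ hc.1 ha T₂.fv T₂.tv hcγ ho' (hsub _ (.inr rfl))⟩
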